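/- arXiv:1703.06403 — 4 statements merged into one kernel-verified Lean document; each statement's English description precedes it below -/
import Mathlib

section
/- Let K₁, K₂ be convex bodies in ℝⁿ and let θ₀ ∈ (0,1) be such that θ₀K₁ ∩ (1−θ₀)K₂ has positive n-dimensional Lebesgue volume. Then vol_{n+1}(conv(({0} × K₂) ∪ ({1} × (−K₁)))) ≤ (1/(n+1)) · vol_n(K₁) · vol_n(K₂) / vol_n(θ₀K₁ ∩ (1−θ₀)K₂), where the convex hull is taken in ℝ × ℝⁿ. -/
open MeasureTheory Set Pointwise
open scoped ENNReal

section RogersShephard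

variable {E F : Type*} [NormedAddCommGroup E] [NormedSpace ℝ E] [FiniteDimensional ℝ E]
  [MeasurableSpace E] [BorelSpace E] [NormedAddCommGroup F] [NormedSpace ℝ F]

/-- The fibres of a convex set over a segment shrink at most linearly away from an end point. -/
theorem Convex.measure_fiber_le {L : Set (F × E)} (hL : Convex ℝ L) (ν : Measure E)
    [ν.IsAddHaarMeasure] (z : F) {w : F} (hw : w ∈ Prod.fst '' L) {r : ℝ} (hr : r ∈ Icc (0 : ℝ) 1) :
    ENNReal.ofReal ((1 - r) ^ Module.finrank ℝ E) * ν (Prod.mk z ⁻¹' L) ≤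
      ν (Prod.mk (AffineMap.homothety z r w) ⁻¹' L) := by
  obtain ⟨⟨w, y⟩, hy, rfl⟩ := hw
  rw [← Measure.addHaar_smul_of_nonneg ν (sub_nonneg.2 hr.2),
    ← measure_vadd ν (r • y) ((1 - r) • (Prod.mk z ⁻¹' L))]
  refine measure_mono ?_
  rintro _ ⟨_, ⟨x, hx, rfl⟩, rfl⟩
  have := hL hx hy (sub_nonneg.2 hr.2) hr.1 (by ring)
  rw [Prod.smul_mk, Prod.smul_mk, Prod.mk_add_mk, add_comm (_ • x)] at this
  have hz : AffineMap.homothety z r w = (1 - r) • z + r • w := by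
    simp only [AffineMap.homothety_apply, vsub_eq_sub, vadd_eq_add]
    module
  rwa [← hz] at this

/-- A Rogers–Shephard inequality between the projection and a fibre of a convex body, in terms of
an arbitrary measure `τ` on the line satisfying `τ [r, 1] ≤ (1 - r) ^ dim E`. -/
theorem Convex.measure_fst_image_mul_measure_fiber_le [FiniteDimensional ℝ F]
    [MeasurableSpace F] [BorelSpace F] {L : Set (F × E)} (hL : Convex ℝ L)
    (hLc : IsCompact L) (μ : Measure F) [μ.IsAddHaarMeasure] (ν : Measure E) [ν.IsAddHaarMeasure]
    (z : F) (τ : Measure ℝ) [SFinite τ]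
    (hτ : ∀ r ∈ Icc (0 : ℝ) 1, τ (Icc r 1) ≤ ENNReal.ofReal ((1 - r) ^ Module.finrank ℝ E)) :
    ν (Prod.mk z ⁻¹' L) * (μ (Prod.fst '' L) *
      ∫⁻ r in Icc (0 : ℝ) 1, ENNReal.ofReal (r ^ Module.finrank ℝ F) ∂τ) ≤ (μ.prod ν) L := by
  set P := Prod.fst '' L with hP
  have hPc : IsCompact P := hLc.image continuous_fst
  set T : Set (F × ℝ) := (fun p : F × ℝ ↦ (AffineMap.homothety z p.2 p.1, p.2)) '' (P ×ˢ Icc 0 1)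
    with hT
  have hTc : IsCompact T := by
    refine (hPc.prod isCompact_Icc).image ?_
    simp only [AffineMap.homothety_apply, vsub_eq_sub, vadd_eq_add]
    fun_prop
  have hM : ν (Prod.mk z ⁻¹' L) ≠ ∞ := by
    have hsub : Prod.mk z ⁻¹' L ⊆ Prod.snd '' L := fun x hx ↦ ⟨(z, x), hx, rfl⟩
    exact measure_ne_top_of_subset hsub (hLc.image continuous_snd).measure_lt_top.ne
  have hTr : ∀ r ∈ Icc (0 : ℝ) 1, (fun w ↦ (w, r)) ⁻¹' T = AffineMap.homothety z r '' P := by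
    intro r hr
    ext w
    constructor
    · rintro ⟨⟨v, s⟩, ⟨hv, -⟩, h⟩
      obtain ⟨h₁, rfl⟩ := Prod.mk.inj h
      exact ⟨v, hv, h₁⟩
    · rintro ⟨v, hv, rfl⟩
      exact ⟨(v, r), ⟨hv, hr⟩, rfl⟩
  have hfib : ∀ w, ν (Prod.mk z ⁻¹' L) * τ (Prod.mk w ⁻¹' T) ≤ ν (Prod.mk w ⁻¹' L) := by
    intro w
    have hsub : Prod.mk w ⁻¹' T ⊆ Icc (0 : ℝ) 1 := by
      rintro r ⟨⟨v, s⟩, ⟨-, hs⟩, h⟩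
      exact (Prod.mk.inj h).2 ▸ hs
    rcases (Prod.mk w ⁻¹' T).eq_empty_or_nonempty with he | hne
    · simp [he]
    have hSc : IsCompact (Prod.mk w ⁻¹' T) :=
      isCompact_Icc.of_isClosed_subset (hTc.isClosed.preimage (by fun_prop)) hsub
    obtain ⟨r, hr, hmin⟩ := hSc.exists_isLeast hne
    obtain ⟨⟨v, s⟩, ⟨hv, -⟩, h⟩ := id hr
    obtain ⟨rfl, rfl⟩ := Prod.mk.inj h
    refine le_trans ?_ (hL.measure_fiber_le ν z hv (hsub hr))
    rw [mul_comm]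
    gcongr
    exact (measure_mono (t := Icc s 1) fun t ht ↦ ⟨hmin ht, (hsub ht).2⟩).trans (hτ _ (hsub hr))
  calc
    _ = ν (Prod.mk z ⁻¹' L) * ∫⁻ r in Icc (0 : ℝ) 1, μ ((fun w ↦ (w, r)) ⁻¹' T) ∂τ := by
      rw [← lintegral_const_mul _ (by fun_prop)]
      congr 1
      refine setLIntegral_congr_fun measurableSet_Icc fun r hr ↦ ?_
      simp only [hTr r hr, Measure.addHaar_image_homothety]
      rw [abs_of_nonneg (pow_nonneg hr.1 _), mul_comm]
    _ ≤ ν (Prod.mk z ⁻¹' L) * ∫⁻ r, μ ((fun w ↦ (w, r)) ⁻¹' T) ∂τ := by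
      exact mul_le_mul_right (setLIntegral_le_lintegral _ _) _
    _ = ∫⁻ w, ν (Prod.mk z ⁻¹' L) * τ (Prod.mk w ⁻¹' T) ∂μ := by
      rw [lintegral_const_mul' _ _ hM, ← Measure.prod_apply_symm hTc.measurableSet,
        Measure.prod_apply hTc.measurableSet]
    _ ≤ ∫⁻ w, ν (Prod.mk w ⁻¹' L) ∂μ := lintegral_mono hfib
    _ = _ := (Measure.prod_apply hLc.measurableSet).symm

end RogersShephard

/-- Integration by parts for the two beta integrals in the volume comparison. -/
theorem integral_pow_succ_mul_one_sub_pow (n : ℕ) :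
    ∫ r in (0 : ℝ)..1, r ^ (n + 2) * ((n + 1) * (1 - r) ^ n) =
      (n + 2) * ∫ r in (0 : ℝ)..1, r ^ (n + 1) * (1 - r) ^ (n + 1) := by
  have hd : ∀ r ∈ uIcc (0 : ℝ) 1, HasDerivAt (fun r : ℝ ↦ r ^ (n + 2) * (1 - r) ^ (n + 1))
      ((n + 2) * (r ^ (n + 1) * (1 - r) ^ (n + 1)) - r ^ (n + 2) * ((n + 1) * (1 - r) ^ n)) r := by
    intro r _
    have h₁ := hasDerivAt_pow (n + 2) r
    have h₂ := ((hasDerivAt_id r).const_sub 1).pow (n + 1)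
    convert! h₁.mul h₂ using 1
    simp
    ring
  have h := intervalIntegral.integral_eq_sub_of_hasDerivAt hd
    (Continuous.intervalIntegrable (by fun_prop) _ _)
  rw [intervalIntegral.integral_sub (Continuous.intervalIntegrable (by fun_prop) _ _)
    (Continuous.intervalIntegrable (by fun_prop) _ _), intervalIntegral.integral_const_mul] at h
  simp at h
  linarith

theorem setLIntegral_Icc_ofReal {f : ℝ → ℝ} (hf : Continuous f) {a b : ℝ} (hab : a ≤ b)
    (h0 : ∀ x ∈ Icc a b, 0 ≤ f x) :
    ∫⁻ x in Icc a b, ENNReal.ofReal (f x) = ENNReal.ofReal (∫ x in a..b, f x) := by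
  rw [intervalIntegral.integral_of_le hab, ← integral_Icc_eq_integral_Ioc,
    ofReal_integral_eq_lintegral_ofReal hf.integrableOn_Icc]
  exact (ae_restrict_iff' measurableSet_Icc).2 (Filter.Eventually.of_forall h0)

/-- A measure on the line with `τ [r, 1] ≤ (1 - r) ^ n` and the extremal moment. -/
theorem exists_measure_Icc_le_one_sub_pow (n : ℕ) :
    ∃ τ : Measure ℝ, SFinite τ ∧
      (∀ r ∈ Icc (0 : ℝ) 1, τ (Icc r 1) ≤ ENNReal.ofReal ((1 - r) ^ n)) ∧
      ∫⁻ r in Icc (0 : ℝ) 1, ENNReal.ofReal (r ^ (n + 1)) ∂τ =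
        (n + 1) * ∫⁻ r in Icc (0 : ℝ) 1, ENNReal.ofReal (r ^ n * (1 - r) ^ n) := by
  cases n with
  | zero =>
    refine ⟨Measure.dirac 1, inferInstance, fun r _ ↦ ?_, ?_⟩
    · simpa using prob_le_one (μ := Measure.dirac (1 : ℝ)) (s := Icc r 1)
    · simp [restrict_dirac' measurableSet_Icc]
  | succ n =>
    have hd : Measurable fun r : ℝ ↦ ENNReal.ofReal ((n + 1) * (1 - r) ^ n) := by fun_prop
    refine ⟨volume.withDensity fun r ↦ ENNReal.ofReal ((n + 1) * (1 - r) ^ n), inferInstance,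
      fun r hr ↦ ?_, ?_⟩
    · rw [withDensity_apply _ measurableSet_Icc, setLIntegral_Icc_ofReal (by fun_prop) hr.2]
      · apply le_of_eq
        congr 1
        have hd : ∀ t ∈ uIcc r 1, HasDerivAt (fun t : ℝ ↦ -(1 - t) ^ (n + 1))
            ((n + 1) * (1 - t) ^ n) t := by
          intro t _
          convert! (((hasDerivAt_id t).const_sub 1).pow (n + 1)).neg using 1
          simp
        rw [intervalIntegral.integral_eq_sub_of_hasDerivAt hd
          (Continuous.intervalIntegrable (by fun_prop) _ _)]
        simp
      · intro t ht
        have := sub_nonneg.2 ht.2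
        positivity
    · rw [setLIntegral_withDensity_eq_setLIntegral_mul _ hd (by fun_prop) measurableSet_Icc,
        setLIntegral_Icc_ofReal (by fun_prop) zero_le_one]
      · have : ∀ r ∈ Icc (0 : ℝ) 1, ((fun r : ℝ ↦ ENNReal.ofReal ((n + 1) * (1 - r) ^ n)) *
            fun r ↦ ENNReal.ofReal (r ^ (n + 1 + 1))) r =
            ENNReal.ofReal (r ^ (n + 2) * ((n + 1) * (1 - r) ^ n)) := by
          intro r hr
          rw [Pi.mul_apply, ENNReal.ofReal_mul (pow_nonneg hr.1 _), mul_comm]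
        rw [setLIntegral_congr_fun measurableSet_Icc this,
          setLIntegral_Icc_ofReal (by fun_prop) zero_le_one, integral_pow_succ_mul_one_sub_pow,
          ENNReal.ofReal_mul (by positivity)]
        · congr 1
          rw [ENNReal.ofReal_add (by positivity) (by positivity)]
          push_cast
          rw [add_assoc, one_add_one_eq_two]
          simp
        · intro t ht
          have := sub_nonneg.2 ht.2
          have := ht.1
          positivity
      · intro t ht
        have := sub_nonneg.2 ht.2
        have := ht.1
        positivity

section Lift

variable {E : Type*} [NormedAddCommGroup E] [NormedSpace ℝ E]

/-- The points `((θ, y - x), x)` with `x ∈ θ • K₁` and `y ∈ (1 - θ) • K₂`: a linear image of the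
convex hull of `{0} × {0} × K₂` and `{1} × K₁ × {0}`. -/
def differenceLift (K₁ K₂ : Set E) : Set ((ℝ × E) × E) :=
  {p | p.1.1 ∈ Icc (0 : ℝ) 1 ∧ p.2 ∈ p.1.1 • K₁ ∧ p.1.2 + p.2 ∈ (1 - p.1.1) • K₂}

theorem Convex.combo_mem_smul {K : Set E} (hK : Convex ℝ K) {a b s t : ℝ} (ha : 0 ≤ a) (hb : 0 ≤ b)
    (hs : 0 ≤ s) (ht : 0 ≤ t) {x y : E} (hx : x ∈ s • K) (hy : y ∈ t • K) :
    a • x + b • y ∈ (a * s + b * t) • K := by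
  rw [hK.add_smul (mul_nonneg ha hs) (mul_nonneg hb ht), mul_smul, mul_smul]
  exact add_mem_add (smul_mem_smul_set hx) (smul_mem_smul_set hy)

theorem convex_differenceLift {K₁ K₂ : Set E} (h₁ : Convex ℝ K₁) (h₂ : Convex ℝ K₂) :
    Convex ℝ (differenceLift K₁ K₂) := by
  rintro ⟨⟨s, u⟩, x⟩ ⟨hs, hx, hu⟩ ⟨⟨t, v⟩, y⟩ ⟨ht, hy, hv⟩ a b ha hb hab
  refine ⟨convex_Icc 0 1 hs ht ha hb hab, h₁.combo_mem_smul ha hb hs.1 ht.1 hx hy, ?_⟩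
  have := h₂.combo_mem_smul ha hb (sub_nonneg.2 hs.2) (sub_nonneg.2 ht.2) hu hv
  have hc : a * (1 - s) + b * (1 - t) = 1 - (a * s + b * t) := by linear_combination hab
  rw [hc] at this
  convert! this using 1
  simp only [Prod.snd_add, Prod.smul_snd, Prod.fst_add, Prod.smul_fst]
  module

theorem isCompact_differenceLift {K₁ K₂ : Set E} (h₁ : IsCompact K₁) (h₂ : IsCompact K₂) :
    IsCompact (differenceLift K₁ K₂) := by
  have : differenceLift K₁ K₂ = (fun p : ℝ × E × E ↦
      ((p.1, (1 - p.1) • p.2.2 - p.1 • p.2.1), p.1 • p.2.1)) '' (Icc 0 1 ×ˢ K₁ ×ˢ K₂) := by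
    ext ⟨⟨t, z⟩, x⟩
    constructor
    · rintro ⟨ht, ⟨a, ha, hx⟩, ⟨b, hb, hz⟩⟩
      refine ⟨(t, a, b), ⟨ht, ha, hb⟩, ?_⟩
      dsimp only at hx hz ⊢
      rw [hz, hx, add_sub_cancel_right]
    · rintro ⟨⟨t, a, b⟩, ⟨ht, ha, hb⟩, h⟩
      cases h
      exact ⟨ht, smul_mem_smul_set ha, by simpa using smul_mem_smul_set hb⟩
  rw [this]
  exact (isCompact_Icc.prod (h₁.prod h₂)).image (by fun_prop)

theorem convexHull_subset_fst_image_differenceLift {K₁ K₂ : Set E} (h₁ : Convex ℝ K₁)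
    (h₂ : Convex ℝ K₂) (hne₁ : K₁.Nonempty) (hne₂ : K₂.Nonempty) :
    convexHull ℝ (({0} : Set ℝ) ×ˢ K₂ ∪ ({1} : Set ℝ) ×ˢ (-K₁)) ⊆
      Prod.fst '' differenceLift K₁ K₂ := by
  refine convexHull_min ?_
    ((convex_differenceLift h₁ h₂).linear_image (LinearMap.fst ℝ (ℝ × E) E))
  rintro ⟨t, z⟩ (⟨ht, hz⟩ | ⟨ht, hz⟩)
  · obtain rfl : t = 0 := ht
    exact ⟨((0, z), 0), ⟨by simp, by simp [zero_smul_set hne₁], by simpa using hz⟩, rfl⟩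
  · obtain rfl : t = 1 := ht
    exact ⟨((1, z), -z), ⟨by simp, by simpa using hz, by simp [zero_smul_set hne₂]⟩, rfl⟩

theorem measure_differenceLift_le [FiniteDimensional ℝ E] [MeasurableSpace E] [BorelSpace E]
    (μ : Measure E) [μ.IsAddHaarMeasure] {K₁ K₂ : Set E} (h₁ : IsCompact K₁) (h₂ : IsCompact K₂) :
    (((volume : Measure ℝ).prod μ).prod μ) (differenceLift K₁ K₂) ≤
      (∫⁻ t in Icc (0 : ℝ) 1, ENNReal.ofReal
        (t ^ Module.finrank ℝ E * (1 - t) ^ Module.finrank ℝ E)) * (μ K₁ * μ K₂) := by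
  have hL := (isCompact_differenceLift h₁ h₂).measurableSet
  have hslice : ∀ t : ℝ, ∫⁻ z, μ (Prod.mk (t, z) ⁻¹' differenceLift K₁ K₂) ∂μ ≤
      (Icc (0 : ℝ) 1).indicator (fun t ↦ ENNReal.ofReal
        (t ^ Module.finrank ℝ E * (1 - t) ^ Module.finrank ℝ E) * (μ K₁ * μ K₂)) t := by
    intro t
    by_cases ht : t ∈ Icc (0 : ℝ) 1
    swap
    · have : ∀ z, Prod.mk (t, z) ⁻¹' differenceLift K₁ K₂ = ∅ := fun z ↦
        eq_empty_of_forall_notMem fun x hx ↦ ht hx.1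
      simp [this]
    have hmeas : MeasurableSet
        ((fun q : E × E ↦ ((t, q.1), q.2)) ⁻¹' differenceLift K₁ K₂) := hL.preimage (by fun_prop)
    calc
      _ = (μ.prod μ) ((fun q : E × E ↦ ((t, q.1), q.2)) ⁻¹' differenceLift K₁ K₂) :=
        (Measure.prod_apply hmeas).symm
      _ = ∫⁻ x, μ ((fun z ↦ (z, x)) ⁻¹'
          ((fun q : E × E ↦ ((t, q.1), q.2)) ⁻¹' differenceLift K₁ K₂)) ∂μ :=
        Measure.prod_apply_symm hmeas
      _ ≤ ∫⁻ x, (t • K₁).indicator (fun _ ↦ μ ((1 - t) • K₂)) x ∂μ := by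
        refine lintegral_mono fun x ↦ ?_
        by_cases hx : x ∈ t • K₁
        · rw [indicator_of_mem hx, ← measure_preimage_add_right μ x ((1 - t) • K₂)]
          exact measure_mono fun z hz ↦ hz.2.2
        · rw [indicator_of_notMem hx, nonpos_iff_eq_zero]
          convert! measure_empty (μ := μ)
          exact eq_empty_of_forall_notMem fun z hz ↦ hx hz.2.1
      _ = _ := by
        rw [lintegral_indicator_const (h₁.smul t).measurableSet, indicator_of_mem ht,
          Measure.addHaar_smul_of_nonneg μ ht.1,
          Measure.addHaar_smul_of_nonneg μ (sub_nonneg.2 ht.2),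
          ENNReal.ofReal_mul (pow_nonneg ht.1 _)]
        ring
  rw [Measure.prod_apply hL, lintegral_prod _ (measurable_measure_prodMk_left hL).aemeasurable,
    ← lintegral_mul_const _ (by fun_prop), ← lintegral_indicator measurableSet_Icc]
  exact lintegral_mono hslice

end Lift

theorem godbersen_stmt8 (n : ℕ)
    (K₁ K₂ : Set (EuclideanSpace ℝ (Fin n)))
    (hK₁_compact : IsCompact K₁) (hK₁_conv : Convex ℝ K₁)
    (hK₁_int : (interior K₁).Nonempty)
    (hK₂_compact : IsCompact K₂) (hK₂_conv : Convex ℝ K₂)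
    (hK₂_int : (interior K₂).Nonempty)
    (θ₀ : ℝ) (hθ₀ : θ₀ ∈ Set.Ioo (0:ℝ) 1)
    (hpos : 0 < volume (θ₀ • K₁ ∩ (1 - θ₀) • K₂)) :
    volume (convexHull ℝ (({0} : Set ℝ) ×ˢ K₂ ∪ ({1} : Set ℝ) ×ˢ (-K₁)))
      ≤ (1 / ((n : ℝ≥0∞) + 1)) *
          (volume K₁ * volume K₂ / volume (θ₀ • K₁ ∩ (1 - θ₀) • K₂)) := by
  obtain ⟨τ, hτs, hτ, hmom⟩ := exists_measure_Icc_le_one_sub_pow n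
  set I := ∫⁻ r in Icc (0 : ℝ) 1, ENNReal.ofReal (r ^ n * (1 - r) ^ n) with hI
  have hIreal := setLIntegral_Icc_ofReal (f := fun r : ℝ ↦ r ^ n * (1 - r) ^ n) (by fun_prop)
    zero_le_one fun r hr ↦ mul_nonneg (pow_nonneg hr.1 _) (pow_nonneg (sub_nonneg.2 hr.2) _)
  have hI_top : I ≠ ∞ := by
    rw [hI, hIreal]
    exact ENNReal.ofReal_ne_top
  have hI_zero : I ≠ 0 := by
    rw [hI, hIreal]
    refine (ENNReal.ofReal_pos.2 ?_).ne'
    refine intervalIntegral.intervalIntegral_pos_of_pos_on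
      (Continuous.intervalIntegrable (by fun_prop) _ _) (fun r hr ↦ ?_) zero_lt_one
    have := sub_pos.2 hr.2
    have := hr.1
    positivity
  have hfiber : Prod.mk (θ₀, 0) ⁻¹' differenceLift K₁ K₂ = θ₀ • K₁ ∩ (1 - θ₀) • K₂ := by
    ext x
    simp [differenceLift, hθ₀.1.le, hθ₀.2.le]
  have hM_top : volume (θ₀ • K₁ ∩ (1 - θ₀) • K₂) ≠ ∞ :=
    measure_ne_top_of_subset inter_subset_left (hK₁_compact.smul θ₀).measure_lt_top.ne
  have hlower := (convex_differenceLift hK₁_conv hK₂_conv).measure_fst_image_mul_measure_fiber_le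
    (isCompact_differenceLift hK₁_compact hK₂_compact)
    ((volume : Measure ℝ).prod volume) volume (θ₀, 0) τ (by simpa using hτ)
  have hupper := measure_differenceLift_le volume hK₁_compact hK₂_compact
  have hdim : Module.finrank ℝ (ℝ × EuclideanSpace ℝ (Fin n)) = n + 1 := by
    simp [add_comm]
  rw [hfiber, hdim, hmom] at hlower
  rw [finrank_euclideanSpace_fin, ← hI] at hupper
  have hsub := measure_mono (μ := volume) (convexHull_subset_fst_image_differenceLift hK₁_conv
    hK₂_conv (hK₁_int.mono interior_subset) (hK₂_int.mono interior_subset))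
  refine hsub.trans ?_
  have hkey := hlower.trans hupper
  rw [← Measure.volume_eq_prod] at hkey
  set M := volume (θ₀ • K₁ ∩ (1 - θ₀) • K₂)
  set A := volume (Prod.fst '' differenceLift K₁ K₂)
  rw [one_div, ← ENNReal.div_eq_inv_mul, ENNReal.le_div_iff_mul_le (by simp) (by simp),
    ENNReal.le_div_iff_mul_le (Or.inl hpos.ne') (Or.inl hM_top),
    ← ENNReal.mul_le_mul_iff_right hI_zero hI_top]
  convert! hkey using 1
  ring
end

section
/- Let K be a convex body in ℝ⁴ and let λ ∈ [0,1]. Then vol((1−λ)K + λ(−K)) ≤ (Σ_{j=0}^{4} binom(4,j)² λ^j (1−λ)^{4−j}) · vol(K), i.e. vol((1−λ)K + λ(−K)) ≤ ((1−λ)⁴ + 16λ(1−λ)³ + 36λ²(1−λ)² + 16λ³(1−λ) + λ⁴) · vol(K). -/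
open MeasureTheory Set Pointwise
open scoped ENNReal

/-- The vectors supported in the index set `σ`. -/
def coordSubmodule {ι : Type*} (σ : Set ι) : Submodule ℝ (ι → ℝ) where
  carrier := {u | ∀ i ∉ σ, u i = 0}
  add_mem' := fun {a b} ha hb i hi => by simp [ha i hi, hb i hi]
  zero_mem' := fun _ _ => rfl
  smul_mem' := fun c a ha i hi => by simp [ha i hi]

section Triangulation

variable {ι W : Type*} [AddCommGroup W] [Module ℝ W]

/-- The index set `σ` is strictly dual feasible for the linear program `min ω w` subject to
`L w = y`, `0 ≤ w`. -/
def IsRegularCell (L : (ι → ℝ) →ₗ[ℝ] W) (ω : Module.Dual ℝ (ι → ℝ)) (σ : Set ι) : Prop :=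
  ∀ u, L u = 0 → (∀ i ∉ σ, 0 ≤ u i) → u ≠ 0 → 0 < ω u

/-- The vector `y` lies in no proper subspace spanned by images of coordinate vectors. -/
def IsGenericFor (L : (ι → ℝ) →ₗ[ℝ] W) (y : W) : Prop :=
  ∀ σ : Set ι, y ∈ (coordSubmodule σ).map L → (coordSubmodule σ).map L = ⊤

theorem IsRegularCell.eq_zero {L : (ι → ℝ) →ₗ[ℝ] W} {ω : Module.Dual ℝ (ι → ℝ)} {σ : Set ι}
    (h : IsRegularCell L ω σ) {u : ι → ℝ} (hu : u ∈ coordSubmodule σ) (hL : L u = 0) : u = 0 := by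
  by_contra hne
  have h1 := h u hL (fun i hi => (hu i hi).ge) hne
  have h2 := h (-u) (by simp [hL]) (fun i hi => by simp [hu i hi]) (neg_ne_zero.2 hne)
  rw [map_neg] at h2
  linarith

theorem IsRegularCell.eq_of_mem {L : (ι → ℝ) →ₗ[ℝ] W} {ω : Module.Dual ℝ (ι → ℝ)} {σ τ : Set ι}
    (hσ : IsRegularCell L ω σ) (hτ : IsRegularCell L ω τ) {y : W} (hy : IsGenericFor L y)
    {w w' : ι → ℝ} (hw : w ∈ coordSubmodule σ) (hw' : w' ∈ coordSubmodule τ)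
    (hw0 : 0 ≤ w) (hw0' : 0 ≤ w') (hL : L w = y) (hL' : L w' = y) : σ = τ := by
  classical
  have heq : w = w' := by
    by_contra hne
    have h1 := hσ (w' - w) (by simp [hL, hL']) (fun i hi => by simpa [hw i hi] using hw0' i)
      (sub_ne_zero.2 (Ne.symm hne))
    have h2 := hτ (w - w') (by simp [hL, hL']) (fun i hi => by simpa [hw' i hi] using hw0 i)
      (sub_ne_zero.2 hne)
    rw [map_sub] at h1 h2
    linarith
  have key : ∀ ρ : Set ι, IsRegularCell L ω ρ → w ∈ coordSubmodule ρ → ρ = {j | w j ≠ 0} := by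
    intro ρ hρ hwρ
    ext i
    refine ⟨fun hi h0 => ?_, fun hi => by_contra fun h => hi (hwρ i h)⟩
    have htop := hy {j | w j ≠ 0} ⟨w, fun j hj => by simpa using hj, hL⟩
    obtain ⟨v, hv, hvL⟩ : L (Pi.single i 1) ∈ (coordSubmodule {j | w j ≠ 0}).map L := by
      rw [htop]; trivial
    have hz : Pi.single i 1 - v = 0 := by
      refine hρ.eq_zero (fun j hj => ?_) (by simp [hvL])
      have hji : j ≠ i := fun h => hj (h ▸ hi)
      have hvj : v j = 0 := hv j (by simpa using hwρ j hj)
      simp [hji, hvj]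
    have hi1 := congrFun hz i
    have hvi : v i = 0 := hv i (by simpa using h0)
    simp [hvi] at hi1
  rw [key σ hσ hw, key τ hτ (heq ▸ hw')]

theorem exists_dual_ne_zero_of_circuit [Finite ι] (L : (ι → ℝ) →ₗ[ℝ] W) :
    ∃ ω : Module.Dual ℝ (ι → ℝ), ∀ (σ : Set ι) (i : ι) (u : ι → ℝ),
      (∀ v ∈ coordSubmodule σ, L v = 0 → v = 0) → L u = 0 → u i = 1 →
      (∀ j ∉ σ, j ≠ i → u j = 0) → ω u ≠ 0 := by
  classical
  let P : Set ι × ι → (ι → ℝ) → Prop := fun a u =>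
    L u = 0 ∧ u a.2 = 1 ∧ ∀ j ∉ a.1, j ≠ a.2 → u j = 0
  let v : Set ι × ι → (ι → ℝ) := fun a => if h : ∃ u, P a u then h.choose else Pi.single a.2 1
  have hv : ∀ a, v a ≠ 0 := by
    intro a h0
    have h1 : v a a.2 = 1 := by
      by_cases h : ∃ u, P a u
      · simp only [v, dif_pos h]; exact h.choose_spec.2.1
      · simp [v, dif_neg h]
    rw [h0] at h1
    simp at h1
  obtain ⟨ω, hω⟩ := Module.exists_dual_forall_apply_ne_zero (K := ℝ) v hv
  refine ⟨ω, fun σ i u hσ hLu hui hu => ?_⟩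
  have h : ∃ u, P (σ, i) u := ⟨u, hLu, hui, hu⟩
  have huv : u = v (σ, i) := by
    have hs := h.choose_spec
    simp only [v, dif_pos h]
    refine sub_eq_zero.1 (hσ _ (fun j hj => ?_) (by rw [map_sub, hLu, hs.1, sub_zero]))
    by_cases hji : j = i
    · subst hji
      have := hs.2.1
      simp only at this
      simp [hui, this]
    · have := hs.2.2 j hj hji
      simp [hu j hj hji, this]
  rw [huv]
  exact hω _

theorem eventually_nonneg_add_smul [Finite ι] {w u : ι → ℝ} (hw : 0 ≤ w)
    (hu : ∀ i, w i = 0 → 0 ≤ u i) : ∀ᶠ ε : ℝ in nhdsWithin 0 (Ioi 0), 0 ≤ w + ε • u := by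
  have : ∀ i, ∀ᶠ ε : ℝ in nhdsWithin 0 (Ioi 0), 0 ≤ w i + ε * u i := by
    intro i
    rcases (hw i).eq_or_lt with h | h
    · filter_upwards [self_mem_nhdsWithin] with ε hε
      rw [← h]
      have := mul_nonneg (le_of_lt hε) (hu i h.symm)
      simpa using this
    · have hc : Filter.Tendsto (fun ε : ℝ => w i + ε * u i) (nhds 0) (nhds (w i + 0 * u i)) :=
        Continuous.tendsto (by fun_prop) 0
      have h' : (0 : ℝ) < w i + 0 * u i := by simpa using h
      exact ((hc.eventually_const_lt h').filter_mono nhdsWithin_le_nhds).mono fun ε hε => le_of_lt hε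
  filter_upwards [Filter.eventually_all.2 this] with ε hε i
  simpa using hε i

theorem exists_isRegularCell_of_mem [Finite ι] {L : (ι → ℝ) →ₗ[ℝ] W}
    {ω : Module.Dual ℝ (ι → ℝ)}
    (hω : ∀ (σ : Set ι) (i : ι) (u : ι → ℝ),
      (∀ v ∈ coordSubmodule σ, L v = 0 → v = 0) → L u = 0 → u i = 1 →
      (∀ j ∉ σ, j ≠ i → u j = 0) → ω u ≠ 0)
    {y : W} (hy : IsGenericFor L y) (hc : IsCompact {w : ι → ℝ | 0 ≤ w ∧ L w = y})
    (hne : {w : ι → ℝ | 0 ≤ w ∧ L w = y}.Nonempty) :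
    ∃ σ, IsRegularCell L ω σ ∧ (coordSubmodule σ).map L = ⊤ ∧
      ∃ w ∈ coordSubmodule σ, 0 ≤ w ∧ L w = y := by
  classical
  have := Fintype.ofFinite ι
  set F := {w : ι → ℝ | 0 ≤ w ∧ L w = y} with hF
  have hωc : Continuous ω := LinearMap.continuous_of_finiteDimensional ω
  obtain ⟨w₀, hw₀, hmin⟩ := hc.exists_isMinOn hne hωc.continuousOn
  have hMc : IsCompact (F ∩ {w | ω w = ω w₀}) :=
    hc.inter_right (isClosed_eq hωc continuous_const)
  obtain ⟨w, hw⟩ := hMc.extremePoints_nonempty ⟨w₀, hw₀, rfl⟩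
  obtain ⟨⟨⟨hw0, hLw⟩, hωw⟩, hext⟩ := mem_extremePoints.1 hw
  have hωw' : ω w = ω w₀ := hωw
  have hmem : ∀ u, L u = 0 → (∀ i, w i = 0 → 0 ≤ u i) →
      ∀ᶠ ε : ℝ in nhdsWithin 0 (Ioi 0), w + ε • u ∈ F := by
    intro u hLu hu
    filter_upwards [eventually_nonneg_add_smul hw0 hu] with ε hε
    exact ⟨hε, by simp [hLw, hLu]⟩
  have hweak : ∀ u, L u = 0 → (∀ i, w i = 0 → 0 ≤ u i) → 0 ≤ ω u := by
    intro u hLu hu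
    obtain ⟨ε, hε, hε0⟩ := ((hmem u hLu hu).and self_mem_nhdsWithin).exists
    have h1 : ω w₀ ≤ ω (w + ε • u) := hmin hε
    rw [map_add, map_smul, smul_eq_mul, hωw'] at h1
    have h2 : 0 ≤ ε * ω u := by linarith
    exact nonneg_of_mul_nonneg_right h2 hε0
  have hind : ∀ u ∈ coordSubmodule {i | w i ≠ 0}, L u = 0 → u = 0 := by
    intro u hu hLu
    have hu' : ∀ i, w i = 0 → u i = 0 := fun i hi => hu i (by simpa using hi)
    have hun' : ∀ i, w i = 0 → (-u) i = 0 := fun i hi => by simp [hu' i hi]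
    have hLn : L (-u) = 0 := by simp [hLu]
    have h1 := hweak u hLu fun i hi => (hu' i hi).ge
    have h2 := hweak (-u) hLn fun i hi => (hun' i hi).ge
    rw [map_neg] at h2
    have h0 : ω u = 0 := by linarith
    obtain ⟨ε, ⟨he1, he2⟩, hε0⟩ := (((hmem u hLu fun i hi => (hu' i hi).ge).and
      (hmem (-u) hLn fun i hi => (hun' i hi).ge)).and self_mem_nhdsWithin).exists
    have hε0' : (0 : ℝ) < ε := hε0
    have hseg : w ∈ openSegment ℝ (w + ε • u) (w + ε • -u) := by
      refine ⟨1 / 2, 1 / 2, by norm_num, by norm_num, by norm_num, ?_⟩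
      ext i
      simp
      ring
    have h3 := hext _ ⟨he1, by simp [h0, hωw']⟩ _ ⟨he2, by simp [h0, hωw']⟩ hseg
    have h4 : ε • u = 0 := by
      have := h3.1
      simpa using this
    exact (smul_eq_zero.1 h4).resolve_left hε0'.ne'
  set σ : Set ι := {i | w i ≠ 0} with hσ
  have hwσ : w ∈ coordSubmodule σ := fun i hi => by simpa [hσ] using hi
  have htop := hy σ ⟨w, hwσ, hLw⟩
  refine ⟨σ, fun u hLu hu hu0 => ?_, htop, w, hwσ, hw0, hLw⟩
  have hd : ∀ i, ∃ d : ι → ℝ, L d = 0 ∧ (i ∉ σ → d i = 1) ∧ ∀ j ∉ σ, j ≠ i → d j = 0 := by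
    intro i
    obtain ⟨v, hv, hvL⟩ : L (Pi.single i 1) ∈ (coordSubmodule σ).map L := by
      rw [htop]; trivial
    refine ⟨Pi.single i 1 - v, by simp [hvL], fun hi => ?_, fun j hj hji => ?_⟩
    · have : v i = 0 := hv i hi
      simp [this]
    · have : v j = 0 := hv j hj
      simp [this, hji]
  choose d hdL hdi hdj using hd
  have hpos : ∀ i ∉ σ, 0 < ω (d i) := by
    intro i hi
    refine lt_of_le_of_ne (hweak _ (hdL i) fun j hj => ?_)
      (hω σ i (d i) hind (hdL i) (hdi i hi) (hdj i)).symm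
    have hjσ : j ∉ σ := by simpa [hσ] using hj
    by_cases hji : j = i
    · subst hji; rw [hdi j hi]; norm_num
    · rw [hdj i j hjσ hji]
  have hsum : u - ∑ i ∈ Finset.univ.filter (· ∉ σ), u i • d i = 0 := by
    refine hind _ (fun j hj => ?_) (by simp [hLu, hdL])
    rw [Pi.sub_apply, Finset.sum_apply, Finset.sum_eq_single j]
    · simp [hdi j hj]
    · intro i _ hij
      simp [hdj i j hj hij.symm]
    · intro h
      simp [hj] at h
  rw [sub_eq_zero.1 hsum, map_sum]
  simp only [map_smul, smul_eq_mul]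
  obtain ⟨i, hi, hui⟩ : ∃ i ∉ σ, u i ≠ 0 := by
    by_contra! h
    exact hu0 (hind u h hLu)
  exact Finset.sum_pos' (fun j hj => mul_nonneg (hu j (by simpa using hj))
    (hpos j (by simpa using hj)).le)
    ⟨i, by simpa using hi, mul_pos (lt_of_le_of_ne (hu i hi) hui.symm) (hpos i hi)⟩

end Triangulation

section Fibres

variable {ι E : Type*} [NormedAddCommGroup E] [NormedSpace ℝ E]

/-- The fibre over `(1, t)` of the cone over the coordinate vectors indexed by `σ`. -/
def coneFibre (L : (ι → ℝ) →ₗ[ℝ] E × ℝ × ℝ) (σ : Set ι) (t : ℝ) : Set E :=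
  {x | ∃ w ∈ coordSubmodule σ, 0 ≤ w ∧ L w = (x, 1, t)}

theorem convex_coneFibre (L : (ι → ℝ) →ₗ[ℝ] E × ℝ × ℝ) (σ : Set ι) (t : ℝ) :
    Convex ℝ (coneFibre L σ t) := by
  rintro x ⟨w, hw, hw0, hL⟩ x' ⟨w', hw', hw0', hL'⟩ a b ha hb hab
  refine ⟨a • w + b • w', add_mem (Submodule.smul_mem _ _ hw) (Submodule.smul_mem _ _ hw'),
    add_nonneg (smul_nonneg ha hw0) (smul_nonneg hb hw0'), ?_⟩
  ext
  · simp [hL, hL']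
  · simpa [hL, hL'] using hab
  · have : a * t + b * t = (a + b) * t := by ring
    simp [hL, hL', this, hab]

theorem coneFibre_mono (L : (ι → ℝ) →ₗ[ℝ] E × ℝ × ℝ) {σ τ : Set ι} (h : σ ⊆ τ) (t : ℝ) :
    coneFibre L σ t ⊆ coneFibre L τ t := by
  rintro x ⟨w, hw, hw0, hL⟩
  exact ⟨w, fun i hi => hw i fun h' => hi (h h'), hw0, hL⟩

variable [Fintype ι]

/-- The coordinates flagged by `c` are summed in the last component of `L`, the others in the
middle one. -/
def IsGraded (c : ι → Bool) (L : (ι → ℝ) →ₗ[ℝ] E × ℝ × ℝ) : Prop :=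
  ∀ w, (L w).2 = (∑ i, if c i then 0 else w i, ∑ i, if c i then w i else 0)

variable {c : ι → Bool} {L : (ι → ℝ) →ₗ[ℝ] E × ℝ × ℝ}

theorem IsGraded.isCompact_feasible (hL : IsGraded c L) (y : E × ℝ × ℝ) :
    IsCompact {w : ι → ℝ | 0 ≤ w ∧ L w = y} := by
  have hLc : Continuous L := LinearMap.continuous_of_finiteDimensional L
  refine (isCompact_Icc (a := (0 : ι → ℝ)) (b := fun _ => y.2.1 + y.2.2)).of_isClosed_subset ?_ ?_
  · exact (isClosed_le continuous_const continuous_id).inter (isClosed_eq hLc continuous_const)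
  · rintro w ⟨hw, hLw⟩
    refine ⟨hw, fun i => ?_⟩
    have h := hL w
    rw [hLw] at h
    have hs : y.2.1 + y.2.2 = ∑ i, w i := by
      rw [h, ← Finset.sum_add_distrib]
      exact Finset.sum_congr rfl fun i _ => by split_ifs <;> simp
    simp only [hs]
    exact Finset.single_le_sum (fun j _ => hw j) (Finset.mem_univ i)

theorem IsGraded.isBounded_coneFibre (hL : IsGraded c L) (σ : Set ι) (t : ℝ) :
    Bornology.IsBounded (coneFibre L σ t) := by
  have hLc : Continuous L := LinearMap.continuous_of_finiteDimensional L
  refine ((isCompact_Icc (a := (0 : ι → ℝ)) (b := fun _ => 1 + t)).image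
    (continuous_fst.comp hLc)).isBounded.subset ?_
  rintro x ⟨w, -, hw, hLw⟩
  refine ⟨w, ⟨hw, fun i => ?_⟩, by simp [hLw]⟩
  have h := hL w
  rw [hLw] at h
  have h1 := congrArg Prod.fst h
  have h2 := congrArg Prod.snd h
  simp only at h1 h2
  have hs : 1 + t = ∑ i, w i := by
    rw [h1, h2, ← Finset.sum_add_distrib]
    exact Finset.sum_congr rfl fun i _ => by split_ifs <;> simp
  simp only [hs]
  exact Finset.single_le_sum (fun j _ => hw j) (Finset.mem_univ i)

variable [FiniteDimensional ℝ E] [MeasurableSpace E] [BorelSpace E]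
  (μ : Measure E) [μ.IsAddHaarMeasure]

theorem IsGraded.ae_isGenericFor (hL : IsGraded c L) {t : ℝ} (ht : t ≠ 0) :
    ∀ᵐ x ∂μ, IsGenericFor L (x, 1, t) := by
  classical
  refine ae_all_iff.2 fun σ => ?_
  by_cases hN : (coordSubmodule σ).map L = ⊤
  · exact Filter.Eventually.of_forall fun _ _ => hN
  let f : E →ᵃ[ℝ] E × ℝ × ℝ :=
    (LinearMap.inl ℝ E (ℝ × ℝ)).toAffineMap + AffineMap.const ℝ E (0, 1, t)
  have hf : ∀ x, f x = (x, 1, t) := fun x => by simp [f]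
  let A : AffineSubspace ℝ E := ((coordSubmodule σ).map L).toAffineSubspace.comap f
  have hA : ∀ x, x ∈ A ↔ (x, (1 : ℝ), t) ∈ (coordSubmodule σ).map L := fun x => by
    rw [← hf]; rfl
  have hne : A ≠ ⊤ := by
    intro htop
    apply hN
    have hall : ∀ x, (x, (1 : ℝ), t) ∈ (coordSubmodule σ).map L := fun x =>
      (hA x).1 (htop ▸ trivial)
    have hE : ∀ x : E, (x, (0 : ℝ), (0 : ℝ)) ∈ (coordSubmodule σ).map L := fun x => by
      have h := sub_mem (hall x) (hall 0)
      rwa [Prod.mk_sub_mk, Prod.mk_sub_mk, sub_self, sub_self, sub_zero] at h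
    have h01 := hall 0
    obtain ⟨w, hw, hLw⟩ := hall 0
    obtain ⟨i, hi⟩ : ∃ i, w i ≠ 0 := by
      by_contra! h
      have : w = 0 := funext h
      rw [this, map_zero] at hLw
      exact zero_ne_one (congrArg (fun z => z.2.1) hLw)
    have hiσ : i ∈ σ := by_contra fun h => hi (hw i h)
    have hs : Pi.single i (1 : ℝ) ∈ coordSubmodule σ := fun j hj => by
      have : j ≠ i := fun h => hj (h ▸ hiσ)
      simp [this]
    have hmem := Submodule.mem_map_of_mem (f := L) hs
    have hg := hL (Pi.single i 1)
    rw [eq_top_iff]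
    rintro ⟨x, a, b⟩ -
    cases hci : c i
    · have hg' : (L (Pi.single i 1)).2 = (1, 0) := by
        rw [hg]; ext
        · simp only
          rw [Finset.sum_eq_single i] <;> simp +contextual [hci]
        · simp only
          refine Finset.sum_eq_zero fun j _ => ?_
          by_cases hji : j = i
          · subst hji; simp [hci]
          · simp [hji]
      have h10 : ((0 : E), (1 : ℝ), (0 : ℝ)) ∈ (coordSubmodule σ).map L := by
        convert sub_mem hmem (hE (L (Pi.single i 1)).1) using 1
        ext <;> simp [hg']
      have h02 : ((0 : E), (0 : ℝ), t) ∈ (coordSubmodule σ).map L := by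
        simpa using sub_mem h01 h10
      convert add_mem (add_mem (hE x) (Submodule.smul_mem _ a h10))
        (Submodule.smul_mem _ (b / t) h02) using 1
      ext <;> simp [ht]
    · have hg' : (L (Pi.single i 1)).2 = (0, 1) := by
        rw [hg]; ext
        · simp only
          refine Finset.sum_eq_zero fun j _ => ?_
          by_cases hji : j = i
          · subst hji; simp [hci]
          · simp [hji]
        · simp only
          rw [Finset.sum_eq_single i] <;> simp +contextual [hci]
      have h10 : ((0 : E), (0 : ℝ), (1 : ℝ)) ∈ (coordSubmodule σ).map L := by
        convert sub_mem hmem (hE (L (Pi.single i 1)).1) using 1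
        ext <;> simp [hg']
      have h02 : ((0 : E), (1 : ℝ), (0 : ℝ)) ∈ (coordSubmodule σ).map L := by
        simpa using sub_mem h01 (Submodule.smul_mem _ t h10)
      convert add_mem (add_mem (hE x) (Submodule.smul_mem _ b h10))
        (Submodule.smul_mem _ a h02) using 1
      ext <;> simp
  have h0 := Measure.addHaar_affineSubspace μ A hne
  filter_upwards [measure_eq_zero_iff_ae_notMem.1 h0] with x hx h
  exact absurd ((hA x).2 h) hx

theorem IsGraded.measureReal_coneFibre_univ (hL : IsGraded c L) :
    ∃ G : Finset (Set ι), (∀ σ ∈ G, (∀ u ∈ coordSubmodule σ, L u = 0 → u = 0) ∧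
        (coordSubmodule σ).map L = ⊤) ∧
      ∀ t : ℝ, 0 < t → μ.real (coneFibre L univ t) = ∑ σ ∈ G, μ.real (coneFibre L σ t) := by
  classical
  obtain ⟨ω, hω⟩ := exists_dual_ne_zero_of_circuit L
  refine ⟨(Set.toFinite {σ | IsRegularCell L ω σ ∧ (coordSubmodule σ).map L = ⊤}).toFinset,
    fun σ hσ => ?_, fun t ht => ?_⟩
  · rw [Set.Finite.mem_toFinset] at hσ
    exact ⟨fun u hu h => hσ.1.eq_zero hu h, hσ.2⟩
  set G := (Set.toFinite {σ | IsRegularCell L ω σ ∧ (coordSubmodule σ).map L = ⊤}).toFinset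
    with hG
  have hgen := hL.ae_isGenericFor μ ht.ne'
  have hae : coneFibre L univ t =ᵐ[μ] ⋃ σ ∈ G, coneFibre L σ t := by
    filter_upwards [hgen] with x hx
    refine propext ⟨?_, ?_⟩
    · rintro ⟨w, -, hw0, hLw⟩
      obtain ⟨σ, hσ, htop, w', hw', hw0', hLw'⟩ := exists_isRegularCell_of_mem hω hx
        (hL.isCompact_feasible _) ⟨w, hw0, hLw⟩
      exact mem_biUnion (by simp [hG, hσ, htop]) (⟨w', hw', hw0', hLw'⟩ : x ∈ coneFibre L σ t)
    · intro h
      obtain ⟨σ, -, hσ⟩ := mem_iUnion₂.1 h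
      exact coneFibre_mono L (subset_univ σ) t hσ
  rw [measureReal_congr hae]
  refine measureReal_biUnion_finset₀ ?_ ?_ ?_
  · intro σ hσ τ hτ hne
    simp only [hG, Set.Finite.coe_toFinset, mem_ofPred_eq] at hσ hτ
    refine measure_mono_null ?_ (measure_eq_zero_iff_ae_notMem.2
      (hgen.mono fun x hx => not_not_intro hx))
    rintro x ⟨⟨w, hw, hw0, hLw⟩, ⟨w', hw', hw0', hLw'⟩⟩ hx
    exact hne (hσ.1.eq_of_mem hτ.1 hx hw hw' hw0 hw0' hLw hLw')
  · exact fun σ _ => (convex_coneFibre L σ t).nullMeasurableSet μ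
  · exact fun σ _ => (hL.isBounded_coneFibre σ t).measure_lt_top.ne

/-- The linear map scaling the coordinates flagged by `c` by `b` and the others by `a`. -/
def colorScale (c : ι → Bool) (a b : ℝ) : (ι → ℝ) →ₗ[ℝ] (ι → ℝ) where
  toFun w i := (if c i then b else a) * w i
  map_add' w w' := by ext i; simp [mul_add]
  map_smul' r w := by ext i; simp [mul_left_comm]

omit [Fintype ι] in
theorem colorScale_mem (c : ι → Bool) (a b : ℝ) {σ : Set ι} {w : ι → ℝ}
    (hw : w ∈ coordSubmodule σ) : colorScale c a b w ∈ coordSubmodule σ :=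
  fun i hi => by simp [colorScale, hw i hi]

omit [Fintype ι] in
theorem colorScale_nonneg (c : ι → Bool) {a b : ℝ} (ha : 0 ≤ a) (hb : 0 ≤ b) {w : ι → ℝ}
    (hw : 0 ≤ w) : 0 ≤ colorScale c a b w :=
  fun i => mul_nonneg (by split_ifs <;> assumption) (hw i)

omit [FiniteDimensional ℝ E] [MeasurableSpace E] [BorelSpace E] in
theorem IsGraded.snd_colorScale (hL : IsGraded c L) (a b : ℝ) (w : ι → ℝ) :
    (L (colorScale c a b w)).2 = (a * (L w).2.1, b * (L w).2.2) := by
  rw [hL, hL]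
  simp only [Finset.mul_sum]
  ext <;> refine Finset.sum_congr rfl fun i _ => ?_ <;> by_cases h : c i <;> simp [colorScale, h]

omit [MeasurableSpace E] [BorelSpace E] in
theorem exists_polynomial_det_add_smul (A B : E →ₗ[ℝ] E) :
    ∃ f : Polynomial ℝ, f.natDegree ≤ Module.finrank ℝ E ∧
      ∀ t : ℝ, LinearMap.det (A + t • B) = f.eval t := by
  let b := Module.finBasis ℝ E
  let M := LinearMap.toMatrix b b A
  let N := LinearMap.toMatrix b b B
  refine ⟨Matrix.det ((Polynomial.X : Polynomial ℝ) • N.map Polynomial.C + M.map Polynomial.C),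
    by simpa using Polynomial.natDegree_det_X_add_C_le N M, fun t => ?_⟩
  rw [← Polynomial.coe_evalRingHom, RingHom.map_det, ← LinearMap.det_toMatrix b]
  congr 1
  ext i j
  simpa [M, N, add_comm] using mul_comm _ _

/-- The volume of the fibre over `(1, t)` of a simplicial cone is polynomial in `t`. -/
theorem IsGraded.exists_polynomial_simplex (hL : IsGraded c L) {σ : Set ι}
    (hind : ∀ u ∈ coordSubmodule σ, L u = 0 → u = 0) (htop : (coordSubmodule σ).map L = ⊤) :
    ∃ f : Polynomial ℝ, f.natDegree ≤ Module.finrank ℝ E ∧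
      ∀ t : ℝ, 0 < t → μ.real (coneFibre L σ t) = f.eval t := by
  let e : coordSubmodule σ ≃ₗ[ℝ] E × ℝ × ℝ := LinearEquiv.ofBijective
    (L ∘ₗ (coordSubmodule σ).subtype)
    ⟨(injective_iff_map_eq_zero _).2 fun u hu => Subtype.ext (hind u u.2 hu), fun y => by
      obtain ⟨w, hw, h⟩ : y ∈ (coordSubmodule σ).map L := by rw [htop]; trivial
      exact ⟨⟨w, hw⟩, h⟩⟩
  let D : ℝ → ℝ → (E × ℝ × ℝ →ₗ[ℝ] E × ℝ × ℝ) := fun a b =>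
    L ∘ₗ colorScale c a b ∘ₗ (coordSubmodule σ).subtype ∘ₗ e.symm.toLinearMap
  have hD : ∀ a b, ∀ w ∈ coordSubmodule σ, D a b (L w) = L (colorScale c a b w) := by
    intro a b w hw
    have : e.symm (L w) = ⟨w, hw⟩ := by
      rw [LinearEquiv.symm_apply_eq]; rfl
    simp [D, this]
  have hsurj : ∀ y, ∃ w ∈ coordSubmodule σ, L w = y := fun y => by
    have : y ∈ (coordSubmodule σ).map L := by rw [htop]; trivial
    exact this
  have hD2 : ∀ a b y, (D a b y).2 = (a * y.2.1, b * y.2.2) := by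
    intro a b y
    obtain ⟨w, hw, rfl⟩ := hsurj y
    rw [hD a b w hw, hL.snd_colorScale]
  let T : ℝ → ℝ → (E →ₗ[ℝ] E) := fun a b =>
    LinearMap.fst ℝ E (ℝ × ℝ) ∘ₗ D a b ∘ₗ LinearMap.inl ℝ E (ℝ × ℝ)
  have hT : ∀ a b x, D a b (x, 0) = (T a b x, 0) := by
    intro a b x
    have h := hD2 a b (x, 0)
    simp only [Prod.fst_zero, Prod.snd_zero, mul_zero] at h
    exact Prod.ext rfl h
  have hTmul : ∀ a b a' b', T (a * a') (b * b') = T a b * T a' b' := by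
    intro a b a' b'
    ext x
    have h : D (a * a') (b * b') (x, 0) = D a b (D a' b' (x, 0)) := by
      obtain ⟨w, hw, hw'⟩ := hsurj (x, 0)
      rw [← hw', hD _ _ w hw, hD _ _ w hw, hD _ _ _ (colorScale_mem c _ _ hw)]
      congr 1
      ext i
      by_cases hi : c i <;> simp [colorScale, hi, mul_assoc]
    rw [hT, hT, hT] at h
    simpa using congrArg Prod.fst h
  have hTadd : ∀ t, T 1 t = T 1 0 + t • T 0 1 := by
    intro t
    ext x
    have h : D 1 t (x, 0) = D 1 0 (x, 0) + t • D 0 1 (x, 0) := by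
      obtain ⟨w, hw, hw'⟩ := hsurj (x, 0)
      rw [← hw', hD _ _ w hw, hD _ _ w hw, hD _ _ w hw, ← map_smul, ← map_add]
      congr 1
      ext i
      by_cases hi : c i <;> simp [colorScale, hi]
    exact congrArg Prod.fst h
  have himage : ∀ t, 0 < t →
      coneFibre L σ t = (fun x => x + (D 1 t (0, 1, 1)).1) '' (T 1 t '' coneFibre L σ 1) := by
    intro t ht
    have hDx : ∀ x, (D 1 t (x, 1, 1)).1 = T 1 t x + (D 1 t (0, 1, 1)).1 := by
      intro x
      have : ((x, 1, 1) : E × ℝ × ℝ) = (x, 0) + (0, 1, 1) := by simp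
      rw [this, map_add]
      rfl
    rw [image_image]
    simp only [← hDx]
    ext z
    constructor
    · rintro ⟨w, hw, hw0, hLw⟩
      have hs := hL.snd_colorScale 1 t⁻¹ w
      rw [hLw] at hs
      simp only [mul_one, inv_mul_cancel₀ ht.ne'] at hs
      have hpt : L (colorScale c 1 t⁻¹ w) = ((L (colorScale c 1 t⁻¹ w)).1, 1, 1) :=
        Prod.ext rfl hs
      refine ⟨(L (colorScale c 1 t⁻¹ w)).1, ⟨_, colorScale_mem c _ _ hw,
        colorScale_nonneg c zero_le_one (inv_pos.2 ht).le hw0, hpt⟩, ?_⟩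
      simp only
      rw [← hpt, hD _ _ _ (colorScale_mem c _ _ hw)]
      have : colorScale c 1 t (colorScale c 1 t⁻¹ w) = w := by
        ext i
        by_cases hi : c i <;> simp [colorScale, hi, ht.ne']
      rw [this, hLw]
    · rintro ⟨x, ⟨w, hw, hw0, hLw⟩, rfl⟩
      refine ⟨_, colorScale_mem c 1 t hw, colorScale_nonneg c zero_le_one ht.le hw0, ?_⟩
      simp only
      rw [← hLw, hD _ _ w hw]
      refine Prod.ext rfl ?_
      rw [hL.snd_colorScale, hLw]
      simp
  have hdet : ∀ t, 0 < t → 0 ≤ LinearMap.det (T 1 t) := by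
    intro t ht
    have h := hTmul 1 (Real.sqrt t) 1 (Real.sqrt t)
    rw [one_mul, Real.mul_self_sqrt ht.le] at h
    rw [h, map_mul]
    exact mul_self_nonneg _
  obtain ⟨f, hf, hfe⟩ := exists_polynomial_det_add_smul (T 1 0) (T 0 1)
  refine ⟨f * Polynomial.C (μ.real (coneFibre L σ 1)),
    (Polynomial.natDegree_mul_C_le _ _).trans hf, fun t ht => ?_⟩
  rw [himage t ht, measureReal_def, Set.image_add_right, measure_preimage_add_right,
    Measure.addHaar_image_linearMap, ENNReal.toReal_mul, abs_of_nonneg (hdet t ht),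
    ENNReal.toReal_ofReal (hdet t ht), hTadd, hfe, Polynomial.eval_mul, Polynomial.eval_C,
    measureReal_def]

theorem IsGraded.exists_polynomial (hL : IsGraded c L) :
    ∃ f : Polynomial ℝ, f.natDegree ≤ Module.finrank ℝ E ∧
      ∀ t : ℝ, 0 < t → μ.real (coneFibre L univ t) = f.eval t := by
  classical
  obtain ⟨G, hG, hsum⟩ := hL.measureReal_coneFibre_univ μ
  have h := fun σ : G => hL.exists_polynomial_simplex μ (hG σ σ.2).1 (hG σ σ.2).2
  choose f hf hfe using h
  refine ⟨∑ σ, f σ, Polynomial.natDegree_sum_le_of_forall_le _ _ fun σ _ => hf σ, fun t ht => ?_⟩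
  rw [hsum t ht, Polynomial.eval_finsetSum, ← Finset.sum_coe_sort]
  exact Finset.sum_congr rfl fun σ _ => hfe σ t ht

end Fibres

theorem mem_convexHull_range_iff {ι E : Type*} [Fintype ι] [AddCommGroup E] [Module ℝ E]
    {p : ι → E} {x : E} :
    x ∈ convexHull ℝ (range p) ↔ ∃ w ∈ stdSimplex ℝ ι, ∑ i, w i • p i = x := by
  classical
  have h : range p = Fintype.linearCombination ℝ p '' range fun i => Pi.single i (1 : ℝ) := by
    rw [← range_comp]
    congr 1
    ext i
    simp
  rw [h, ← LinearMap.image_convexHull, convexHull_rangle_single_eq_stdSimplex]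
  simp [Fintype.linearCombination_apply]

theorem exists_polynomial_measureReal_add_smul {ι κ E : Type*} [Fintype ι] [Fintype κ]
    [NormedAddCommGroup E] [NormedSpace ℝ E] [FiniteDimensional ℝ E] [MeasurableSpace E]
    [BorelSpace E] (μ : Measure E) [μ.IsAddHaarMeasure] (p : ι → E) (q : κ → E) :
    ∃ f : Polynomial ℝ, f.natDegree ≤ Module.finrank ℝ E ∧ ∀ t : ℝ, 0 < t →
      μ.real (convexHull ℝ (range p) + t • convexHull ℝ (range q)) = f.eval t := by
  let L : (ι ⊕ κ → ℝ) →ₗ[ℝ] E × ℝ × ℝ := Fintype.linearCombination ℝ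
    (Sum.elim (fun i => (p i, 1, 0)) (fun j => (q j, 0, 1)))
  have hLw : ∀ w, L w = (∑ i, w (Sum.inl i) • p i + ∑ j, w (Sum.inr j) • q j,
      ∑ i, w (Sum.inl i), ∑ j, w (Sum.inr j)) := by
    intro w
    simp only [L, Fintype.linearCombination_apply, Fintype.sum_sum_type, Sum.elim_inl,
      Sum.elim_inr]
    ext <;> simp [Prod.fst_sum, Prod.snd_sum]
  have hL : IsGraded Sum.isRight L := by
    intro w
    simp [hLw, Fintype.sum_sum_type]
  obtain ⟨f, hf, hfe⟩ := hL.exists_polynomial μ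
  refine ⟨f, hf, fun t ht => ?_⟩
  rw [← hfe t ht]
  congr 1
  ext x
  simp only [mem_add, mem_smul_set, mem_convexHull_range_iff]
  constructor
  · rintro ⟨a, ⟨u, hu, rfl⟩, _, ⟨b, ⟨v, hv, rfl⟩, rfl⟩, rfl⟩
    refine ⟨Sum.elim u (t • v), fun i hi => absurd (mem_univ i) hi, ?_, ?_⟩
    · rintro (i | j)
      · exact hu.1 i
      · exact mul_nonneg ht.le (hv.1 j)
    · rw [hLw]
      simp [hu.2, ← Finset.mul_sum, hv.2, Finset.smul_sum, mul_smul]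
  · rintro ⟨w, -, hw0, hw⟩
    rw [hLw] at hw
    simp only [Prod.mk.injEq] at hw
    refine ⟨_, ⟨fun i => w (Sum.inl i), ⟨fun i => hw0 _, hw.2.1⟩, rfl⟩, _,
      ⟨_, ⟨fun j => t⁻¹ * w (Sum.inr j), ⟨fun j => mul_nonneg (inv_pos.2 ht).le (hw0 _), ?_⟩,
        rfl⟩, rfl⟩, ?_⟩
    · rw [← Finset.mul_sum, hw.2.2, inv_mul_cancel₀ ht.ne']
    · rw [← hw.1, Finset.smul_sum]
      simp [← mul_smul, ht.ne']

section ConvexBody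

variable {E : Type*} [NormedAddCommGroup E] [NormedSpace ℝ E] [FiniteDimensional ℝ E]

/-- A convex body of dimension `n` contains a translate of `-K / n`. -/
theorem exists_neg_eq_add_finrank_smul {K : Set E} (hK : IsCompact K) (hKc : Convex ℝ K)
    (hne : K.Nonempty) (hn : 0 < Module.finrank ℝ E) :
    ∃ z, ∀ x ∈ K, ∃ k ∈ K, -x = z + (Module.finrank ℝ E : ℝ) • k := by
  classical
  obtain ⟨x₀, hx₀⟩ := hne
  set n := Module.finrank ℝ E
  have hn' : (0 : ℝ) < n := by exact_mod_cast hn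
  let F : K → Set E := fun x => (fun k => -(x : E) - (n : ℝ) • k) '' K
  have hF : ∀ x : K, F x = AffineMap.homothety (-(1 / (1 + n) : ℝ) • (x : E)) (-n : ℝ) '' K := by
    intro x
    refine image_congr fun k _ => ?_
    have : (1 + (n : ℝ)) ≠ 0 := by positivity
    simp only [AffineMap.homothety_apply, vsub_eq_sub, vadd_eq_add]
    match_scalars <;> field_simp
    ring
  obtain ⟨z, hz⟩ : (⋂ x, F x).Nonempty := by
    refine Convex.helly_theorem_compact' (𝕜 := ℝ) (fun x => ?_) (fun x => ?_) fun I hI => ?_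
    · rw [hF]; exact hKc.affine_image _
    · exact hK.image (by fun_prop)
    · refine ⟨-(∑ y ∈ I, (y : E)) - ((n : ℝ) + 1 - I.card) • x₀, mem_iInter₂.2 fun x hx => ?_⟩
      have hcard : (I.card : ℝ) ≤ n + 1 := by exact_mod_cast hI
      have hce : ((I.erase x).card : ℝ) = I.card - 1 := by
        rw [Finset.card_erase_of_mem hx, Nat.cast_sub (Finset.card_pos.2 ⟨x, hx⟩), Nat.cast_one]
      let w : Option (I.erase x) → ℝ := fun o => o.elim (((n : ℝ) + 1 - I.card) / n) fun _ => 1 / n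
      let v : Option (I.erase x) → E := fun o => o.elim x₀ fun y => (y : K)
      have hmem : ∑ o, w o • v o ∈ K := by
        refine hKc.sum_mem (fun o _ => ?_) ?_ fun o _ => ?_
        · rcases o with _ | o
          · exact div_nonneg (by linarith) hn'.le
          · exact (one_div_pos.2 hn').le
        · rw [Fintype.sum_option]
          simp only [w, Option.elim, Finset.sum_const, Finset.card_univ, Fintype.card_coe,
            nsmul_eq_mul, hce]
          field_simp
          ring
        · rcases o with _ | o
          · exact hx₀
          · exact o.1.2
      refine ⟨_, hmem, ?_⟩
      have hsum : ∑ o, w o • v o = (((n : ℝ) + 1 - I.card) / n) • x₀ +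
          (1 / n : ℝ) • ∑ y ∈ I.erase x, (y : E) := by
        rw [Fintype.sum_option, Finset.smul_sum, ← Finset.sum_coe_sort (I.erase x)]
        rfl
      simp only [hsum]
      rw [← Finset.add_sum_erase I _ hx, smul_add, smul_smul, smul_smul,
        mul_div_cancel₀ _ hn'.ne', mul_one_div_cancel hn'.ne', one_smul]
      abel
  refine ⟨z, fun x hx => ?_⟩
  obtain ⟨k, hk, hkz⟩ := mem_iInter.1 hz ⟨x, hx⟩
  refine ⟨k, hk, ?_⟩
  simp only at hkz
  rw [← hkz]
  abel

variable [MeasurableSpace E] [BorelSpace E] (μ : Measure E) [μ.IsAddHaarMeasure]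

theorem measure_add_smul_neg_le {K : Set E} (hK : IsCompact K) (hKc : Convex ℝ K)
    (hne : K.Nonempty) (hn : 0 < Module.finrank ℝ E) {t : ℝ} (ht : 0 ≤ t) :
    μ (K + t • -K) ≤
      ENNReal.ofReal ((1 + Module.finrank ℝ E * t) ^ Module.finrank ℝ E) * μ K := by
  obtain ⟨z, hz⟩ := exists_neg_eq_add_finrank_smul hK hKc hne hn
  have hpos : 0 ≤ 1 + Module.finrank ℝ E * t := by positivity
  have hsub : K + t • -K ⊆ (t • z) +ᵥ (1 + Module.finrank ℝ E * t) • K := by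
    rintro _ ⟨x, hx, _, ⟨y, hy, rfl⟩, rfl⟩
    obtain ⟨k, hk, hyk⟩ := hz (-y) hy
    rw [neg_neg] at hyk
    rw [hKc.add_smul zero_le_one (by positivity), one_smul]
    refine ⟨x + (Module.finrank ℝ E * t) • k, add_mem_add hx (smul_mem_smul_set hk), ?_⟩
    simp only [vadd_eq_add, hyk, smul_add, smul_smul]
    rw [mul_comm t]
    abel
  refine (measure_mono hsub).trans ?_
  rw [measure_vadd, Measure.addHaar_smul_of_nonneg _ hpos]

theorem measure_le_add_smul_neg {K : Set E} (hne : K.Nonempty) (t : ℝ) :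
    μ K ≤ μ (K + t • -K) := by
  obtain ⟨x, hx⟩ := hne
  have hsub : (t • -x) +ᵥ K ⊆ K + t • -K := by
    rintro _ ⟨y, hy, rfl⟩
    refine ⟨y, hy, t • -x, smul_mem_smul_set (by simpa using hx), ?_⟩
    simp [add_comm]
  calc μ K = μ ((t • -x) +ᵥ K) := (measure_vadd _ _ _).symm
    _ ≤ _ := measure_mono hsub

theorem measureReal_add_smul_neg_inv (K : Set E) {t : ℝ} (ht : 0 < t) :
    μ.real (K + t • -K) = t ^ Module.finrank ℝ E * μ.real (K + t⁻¹ • -K) := by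
  have h : K + t • -K = (-t) • (K + t⁻¹ • -K) := by
    rw [smul_add, smul_smul, neg_mul, mul_inv_cancel₀ ht.ne', neg_smul_set, neg_smul_set, one_smul,
      neg_neg, smul_set_neg, add_comm]
  rw [h, measureReal_def, Measure.addHaar_smul, ENNReal.toReal_mul, abs_pow, abs_neg,
    abs_of_pos ht, ENNReal.toReal_ofReal (by positivity), measureReal_def]

end ConvexBody

theorem integral_one_sub_pow_four_mul_cube :
    ∫ t in (0 : ℝ)..1, (1 - t) ^ 4 * t ^ 3 = 1 / 280 := by
  have hd : ∀ t ∈ uIcc (0 : ℝ) 1, HasDerivAt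
      (fun t : ℝ => t ^ 4 / 4 - 4 * t ^ 5 / 5 + t ^ 6 - 4 * t ^ 7 / 7 + t ^ 8 / 8)
      ((1 - t) ^ 4 * t ^ 3) t := by
    intro t _
    refine ((((((hasDerivAt_pow 4 t).div_const 4).sub
      (((hasDerivAt_pow 5 t).const_mul 4).div_const 5)).add (hasDerivAt_pow 6 t)).sub
      (((hasDerivAt_pow 7 t).const_mul 4).div_const 7)).add
      ((hasDerivAt_pow 8 t).div_const 8)).congr_deriv ?_
    norm_num
    ring
  rw [intervalIntegral.integral_eq_sub_of_hasDerivAt hd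
    (Continuous.intervalIntegrable (by fun_prop) _ _)]
  norm_num

/-- The Rogers–Shephard inequality in dimension four. -/
theorem measure_sub_self_le_of_finrank_eq_four {E : Type*} [NormedAddCommGroup E]
    [NormedSpace ℝ E] [FiniteDimensional ℝ E] [MeasurableSpace E] [BorelSpace E] (μ : Measure E)
    [μ.IsAddHaarMeasure] (hE : Module.finrank ℝ E = 4) {K : Set E} (hK : IsCompact K)
    (hKc : Convex ℝ K) (hV : μ K ≠ 0) : μ (K - K) ≤ 70 * μ K := by
  have hVt : μ K ≠ ⊤ := hK.measure_lt_top.ne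
  have hVpos : 0 < (μ K).toReal := ENNReal.toReal_pos hV hVt
  let S : Set (E × E) := {z | z.2 ∈ K ∧ z.2 - z.1 ∈ K}
  have hSc : IsClosed S := (hK.isClosed.preimage continuous_snd).inter
    (hK.isClosed.preimage (continuous_snd.sub continuous_fst))
  have hSm : MeasurableSet S := hSc.measurableSet
  let g : E → ℝ≥0∞ := fun x => μ (Prod.mk x ⁻¹' S)
  have hgm : Measurable g := measurable_measure_prodMk_left hSm
  have hgle : ∀ x, g x ≤ μ K := fun x => measure_mono fun y hy => hy.1
  have hgint : ∫⁻ x, g x ∂μ = μ K * μ K := by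
    have h1 : (μ.prod μ) S = ∫⁻ x, g x ∂μ := Measure.prod_apply hSm
    rw [← h1, Measure.prod_apply_symm hSm]
    have h2 : ∀ y, μ ((fun x => (x, y)) ⁻¹' S) = K.indicator (fun _ => μ K) y := by
      intro y
      by_cases hy : y ∈ K
      · have : (fun x => (x, y)) ⁻¹' S = (fun x => y - x) ⁻¹' K := by
          ext x; simp [S, hy]
        rw [this, indicator_of_mem hy, (Measure.measurePreserving_sub_left μ y).measure_preimage
          hK.measurableSet.nullMeasurableSet]
      · have : (fun x => (x, y)) ⁻¹' S = ∅ := by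
          ext x; simp [S, hy]
        rw [this, indicator_of_notMem hy, measure_empty]
    simp only [h2]
    rw [lintegral_indicator hK.measurableSet, setLIntegral_const]
  let f : E → ℝ := fun x => ((g x).toReal / (μ K).toReal) ^ (4 : ℝ)⁻¹
  have hf0 : ∀ x, 0 ≤ f x := fun x => by positivity
  have hfm : Measurable f := (hgm.ennreal_toReal.div_const _).pow_const _
  have hf4 : ∀ x, ENNReal.ofReal (f x ^ (4 : ℝ)) = g x / μ K := by
    intro x
    have h1 : f x ^ (4 : ℝ) = (g x / μ K).toReal := by
      simp only [f]
      rw [Real.rpow_inv_rpow (by positivity) (by norm_num), ENNReal.toReal_div]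
    rw [h1, ENNReal.ofReal_toReal]
    exact ENNReal.div_ne_top ((hgle x).trans_lt hVt.lt_top).ne hV
  have hlower : ∀ t ∈ Ioc (0 : ℝ) 1,
      ENNReal.ofReal ((1 - t) ^ 4) * μ (K - K) ≤ μ {x | t ≤ f x} := by
    intro t ht
    rw [← hE, ← Measure.addHaar_smul_of_nonneg μ (by linarith [ht.2] : 0 ≤ 1 - t)]
    refine measure_mono ?_
    rintro _ ⟨_, ⟨a, ha, b, hb, rfl⟩, rfl⟩
    have hsub : ((1 - t) • a) +ᵥ t • K ⊆ Prod.mk ((1 - t) • (a - b)) ⁻¹' S := by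
      rintro _ ⟨_, ⟨k, hk, rfl⟩, rfl⟩
      have hc : ∀ c ∈ K, (1 - t) • c + t • k ∈ K := fun c hc =>
        hKc hc hk (by linarith [ht.2]) ht.1.le (by ring)
      refine ⟨hc a ha, ?_⟩
      have : (1 - t) • a + t • k - (1 - t) • (a - b) = (1 - t) • b + t • k := by
        rw [smul_sub]; abel
      simp only [vadd_eq_add, this]
      exact hc b hb
    have hle := measure_mono (μ := μ) hsub
    rw [measure_vadd, Measure.addHaar_smul_of_nonneg μ ht.1.le, hE] at hle
    have hle' : t ^ 4 * (μ K).toReal ≤ (g ((1 - t) • (a - b))).toReal := by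
      have := ENNReal.toReal_mono ((hgle _).trans_lt hVt.lt_top).ne hle
      rwa [ENNReal.toReal_mul, ENNReal.toReal_ofReal (pow_nonneg ht.1.le _)] at this
    show t ≤ f _
    rw [Real.le_rpow_inv_iff_of_pos ht.1.le (by positivity) (by norm_num), le_div_iff₀ hVpos]
    exact_mod_cast hle'
  have hlayer := lintegral_rpow_eq_lintegral_meas_le_mul μ (Filter.Eventually.of_forall hf0)
    hfm.aemeasurable (by norm_num : (0 : ℝ) < 4)
  have hleft : ∫⁻ x, ENNReal.ofReal (f x ^ (4 : ℝ)) ∂μ = μ K := by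
    simp only [hf4, div_eq_mul_inv]
    rw [lintegral_mul_const _ hgm, hgint, mul_assoc, ENNReal.mul_inv_cancel hV hVt, mul_one]
  have hint : ∫⁻ t in Ioc (0 : ℝ) 1, ENNReal.ofReal ((1 - t) ^ 4 * t ^ 3) =
      ENNReal.ofReal (1 / 280) := by
    rw [← ofReal_integral_eq_lintegral_ofReal, ← intervalIntegral.integral_of_le zero_le_one,
      integral_one_sub_pow_four_mul_cube]
    · exact (Continuous.integrableOn_Icc (by fun_prop)).mono_set Ioc_subset_Icc_self
    · filter_upwards [self_mem_ae_restrict measurableSet_Ioc] with t ht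
      have := ht.1
      have : 0 ≤ 1 - t := by linarith [ht.2]
      simp only [Pi.zero_apply]
      positivity
  have hright : ENNReal.ofReal (1 / 280) * μ (K - K) ≤
      ∫⁻ t in Ioi (0 : ℝ), μ {x | t ≤ f x} * ENNReal.ofReal (t ^ ((4 : ℝ) - 1)) := by
    rw [← hint, ← lintegral_mul_const _ (by fun_prop)]
    refine le_trans ?_ (lintegral_mono_set (Ioc_subset_Ioi_self : Ioc (0 : ℝ) 1 ⊆ Ioi 0))
    refine setLIntegral_mono' measurableSet_Ioc fun t ht => ?_
    have h3 : t ^ ((4 : ℝ) - 1) = t ^ 3 := by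
      rw [show (4 : ℝ) - 1 = (3 : ℕ) by norm_num, Real.rpow_natCast]
    rw [h3, ENNReal.ofReal_mul (by have := ht.2; positivity), mul_right_comm]
    gcongr
    exact hlower t ht
  rw [hleft] at hlayer
  have hfin : ENNReal.ofReal 4 * (ENNReal.ofReal (1 / 280) * μ (K - K)) ≤ μ K := by
    rw [hlayer]; gcongr
  rw [← mul_assoc, ← ENNReal.ofReal_mul (by norm_num)] at hfin
  calc μ (K - K) = 70 * (ENNReal.ofReal (4 * (1 / 280)) * μ (K - K)) := by
        rw [← mul_assoc, ← ENNReal.ofReal_ofNat 70, ← ENNReal.ofReal_mul (by norm_num)]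
        norm_num
    _ ≤ 70 * μ K := by gcongr

theorem le_at_zero_of_forall_pos {a b : ℝ → ℝ} (ha : Continuous a) (hb : Continuous b)
    (h : ∀ t, 0 < t → a t ≤ b t) : a 0 ≤ b 0 :=
  le_of_tendsto_of_tendsto (ha.continuousWithinAt (s := Ioi 0) (x := 0))
    (hb.continuousWithinAt (s := Ioi 0) (x := 0))
    (by filter_upwards [self_mem_nhdsWithin] with t ht using h t ht)

/-- A reciprocal quartic with the bounds satisfied by the volume of `K - t K` is dominated by the
polynomial of the simplex. -/
theorem quartic_le_of_bounds {f : Polynomial ℝ} (hf : f.natDegree ≤ 4) {V : ℝ}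
    (hlow : ∀ t, 0 < t → V ≤ f.eval t) (hup : ∀ t, 0 < t → f.eval t ≤ (1 + 4 * t) ^ 4 * V)
    (hrec : ∀ t, 0 < t → f.eval t = t ^ 4 * f.eval t⁻¹) (hone : f.eval 1 ≤ 70 * V)
    {t : ℝ} (ht : 0 < t) :
    f.eval t ≤ (1 + 16 * t + 36 * t ^ 2 + 16 * t ^ 3 + t ^ 4) * V := by
  obtain ⟨c₀, c₁, c₂, c₃, c₄, hc⟩ : ∃ c₀ c₁ c₂ c₃ c₄ : ℝ, ∀ t,
      f.eval t = c₀ + c₁ * t + c₂ * t ^ 2 + c₃ * t ^ 3 + c₄ * t ^ 4 := by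
    refine ⟨f.coeff 0, f.coeff 1, f.coeff 2, f.coeff 3, f.coeff 4, fun t => ?_⟩
    rw [Polynomial.eval_eq_sum_range' (Nat.lt_succ_of_le hf)]
    simp [Finset.sum_range_succ]
  simp only [hc] at *
  have h0 : c₀ = V := by
    have h1 := le_at_zero_of_forall_pos (by fun_prop) (by fun_prop) hlow
    have h2 := le_at_zero_of_forall_pos (by fun_prop) (by fun_prop) hup
    norm_num at h1 h2
    linarith
  have h1 : c₁ ≤ 16 * V := by
    have h := le_at_zero_of_forall_pos
      (a := fun t => c₁ + c₂ * t + c₃ * t ^ 2 + c₄ * t ^ 3)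
      (b := fun t => (16 + 96 * t + 256 * t ^ 2 + 256 * t ^ 3) * V)
      (by fun_prop) (by fun_prop) (fun t ht => by
        have h := hup t ht
        rw [h0] at h
        refine le_of_mul_le_mul_left ?_ ht
        linarith)
    simpa using h
  have h2 := hrec 2 (by norm_num)
  have h3 := hrec 3 (by norm_num)
  norm_num at h2 h3 hone
  have h4 : c₄ = V := by linarith
  have h31 : c₃ = c₁ := by linarith
  rw [h4, h31, h0] at *
  have hc2 : c₂ ≤ 68 * V - 2 * c₁ := by linarith
  have e1 : 0 ≤ t ^ 2 * (68 * V - 2 * c₁ - c₂) := mul_nonneg (by positivity) (by linarith)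
  have e2 : 0 ≤ t * (1 - t) ^ 2 * (16 * V - c₁) := mul_nonneg (by positivity) (by linarith)
  linarith

section DimensionFour

variable {E : Type*} [NormedAddCommGroup E] [NormedSpace ℝ E] [FiniteDimensional ℝ E]
  [MeasurableSpace E] [BorelSpace E] (μ : Measure E) [μ.IsAddHaarMeasure]

theorem measureReal_polytope_add_smul_neg_le (hE : Module.finrank ℝ E = 4) {ι : Type*} [Fintype ι]
    [Nonempty ι] (p : ι → E) {t : ℝ} (ht : 0 < t) :
    μ.real (convexHull ℝ (range p) + t • -convexHull ℝ (range p)) ≤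
      (1 + 16 * t + 36 * t ^ 2 + 16 * t ^ 3 + t ^ 4) * μ.real (convexHull ℝ (range p)) := by
  obtain ⟨f, hf, hfe⟩ := exists_polynomial_measureReal_add_smul μ p (-p)
  have hneg : convexHull ℝ (range (-p)) = -convexHull ℝ (range p) := by
    rw [← convexHull_neg, ← image_neg_eq_neg, ← range_comp]; rfl
  rw [hneg] at hfe
  rw [hE] at hf
  set P := convexHull ℝ (range p) with hP
  have hPc : IsCompact P := (finite_range p).isCompact_convexHull ℝ
  have hPconv : Convex ℝ P := convex_convexHull ℝ _
  have hPne : P.Nonempty := (range_nonempty p).convexHull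
  have hfin : ∀ s : ℝ, μ (P + s • -P) ≠ ⊤ := fun s =>
    (hPc.add (hPc.neg.smul s)).measure_lt_top.ne
  have hup : ∀ s, 0 < s → μ.real (P + s • -P) ≤ (1 + 4 * s) ^ 4 * μ.real P := by
    intro s hs
    have h := measure_add_smul_neg_le μ hPc hPconv hPne (by omega) hs.le
    rw [hE] at h
    have h' := ENNReal.toReal_mono
      (ENNReal.mul_ne_top ENNReal.ofReal_ne_top hPc.measure_lt_top.ne) h
    rw [ENNReal.toReal_mul, ENNReal.toReal_ofReal (by positivity)] at h'
    exact_mod_cast h'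
  rw [hfe t ht]
  refine quartic_le_of_bounds hf (fun s hs => ?_) (fun s hs => ?_) (fun s hs => ?_) ?_ ht
  · rw [← hfe s hs]
    exact ENNReal.toReal_mono (hfin s) (measure_le_add_smul_neg μ hPne s)
  · rw [← hfe s hs]
    exact hup s hs
  · rw [← hfe s hs, ← hfe _ (inv_pos.2 hs), measureReal_add_smul_neg_inv μ P hs, hE]
  · rw [← hfe 1 one_pos]
    by_cases hV : μ P = 0
    · have h := hup 1 one_pos
      simp only [measureReal_def, hV, ENNReal.toReal_zero, mul_zero] at h ⊢
      exact h
    · have h := measure_sub_self_le_of_finrank_eq_four μ hE hPc hPconv hV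
      have h' := ENNReal.toReal_mono
        (ENNReal.mul_ne_top (by norm_num) hPc.measure_lt_top.ne) h
      rw [ENNReal.toReal_mul] at h'
      rw [one_smul, ← sub_eq_add_neg]
      exact_mod_cast h'

theorem measure_polytope_unbalanced_difference_le (hE : Module.finrank ℝ E = 4) {ι : Type*}
    [Fintype ι] [Nonempty ι] (p : ι → E) {l : ℝ} (hl0 : 0 < l) (hl1 : l < 1) :
    μ ((1 - l) • convexHull ℝ (range p) + l • -convexHull ℝ (range p)) ≤
      ENNReal.ofReal ((1 - l) ^ 4 + 16 * l * (1 - l) ^ 3 + 36 * l ^ 2 * (1 - l) ^ 2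
        + 16 * l ^ 3 * (1 - l) + l ^ 4) * μ (convexHull ℝ (range p)) := by
  have h1 : 0 < 1 - l := by linarith
  have h := measureReal_polytope_add_smul_neg_le μ hE p (div_pos hl0 h1)
  set P := convexHull ℝ (range p) with hP
  have hPc : IsCompact P := (finite_range p).isCompact_convexHull ℝ
  have hset : (1 - l) • P + l • -P = (1 - l) • (P + (l / (1 - l)) • -P) := by
    rw [smul_add, smul_smul, mul_div_cancel₀ _ h1.ne']
  rw [hset, Measure.addHaar_smul_of_nonneg μ h1.le, hE,
    ← ofReal_measureReal (hPc.add (hPc.neg.smul _)).measure_lt_top.ne,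
    ← ofReal_measureReal hPc.measure_lt_top.ne, ← ENNReal.ofReal_mul (by positivity),
    ← ENNReal.ofReal_mul (by positivity)]
  refine ENNReal.ofReal_le_ofReal ((mul_le_mul_of_nonneg_left h (by positivity)).trans_eq ?_)
  field_simp

theorem measure_unbalanced_difference_le (hE : Module.finrank ℝ E = 4) {K : Set E}
    (hKc : Convex ℝ K) (hne : K.Nonempty) {l : ℝ} (hl0 : 0 < l) (hl1 : l < 1) :
    μ ((1 - l) • K + l • -K) ≤
      ENNReal.ofReal ((1 - l) ^ 4 + 16 * l * (1 - l) ^ 3 + 36 * l ^ 2 * (1 - l) ^ 2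
        + 16 * l ^ 3 * (1 - l) + l ^ 4) * μ K := by
  have := hne.to_subtype
  let d : ℕ → E := fun n => TopologicalSpace.denseSeq K n
  have hdK : ∀ n, d n ∈ K := fun n => (TopologicalSpace.denseSeq K n).2
  let P : ℕ → Set E := fun n => convexHull ℝ (range fun i : Fin (n + 1) => d i)
  have hPK : ∀ n, P n ⊆ K := fun n => convexHull_min (range_subset_iff.2 fun i => hdK i) hKc
  have hPmono : Monotone P := fun m n hmn => convexHull_mono (range_subset_iff.2 fun i =>
    ⟨⟨i, by omega⟩, rfl⟩)
  have hdP : ∀ n, d n ∈ P n := fun n => subset_convexHull ℝ _ ⟨Fin.last n, rfl⟩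
  let Q : ℕ → Set E := fun n => (1 - l) • P n + l • -P n
  have hQmono : Monotone Q := fun m n hmn =>
    add_subset_add (smul_set_mono (hPmono hmn)) (smul_set_mono (neg_subset_neg.2 (hPmono hmn)))
  have hQc : Convex ℝ (⋃ n, Q n) := (hQmono.directed_le).convex_iUnion fun {n} =>
    ((convex_convexHull ℝ _).smul _).add ((convex_convexHull ℝ _).neg.smul _)
  have hsub : (1 - l) • K + l • -K ⊆ closure (⋃ n, Q n) := by
    have hdense : K ⊆ closure (range d) := by
      intro x hx
      have h := (TopologicalSpace.denseRange_denseSeq K) ⟨x, hx⟩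
      have h2 := mem_closure_image (f := ((↑) : K → E)) continuous_subtype_val.continuousAt h
      rwa [← range_comp] at h2
    rintro _ ⟨_, ⟨x, hx, rfl⟩, _, ⟨y, hy, rfl⟩, rfl⟩
    have hy' : -y ∈ K := hy
    have hcont : Continuous fun z : E × E => (1 - l) • z.1 - l • z.2 := by fun_prop
    have hxy : (x, -y) ∈ closure (range d ×ˢ range d) := by
      rw [closure_prod_eq]
      exact ⟨hdense hx, hdense hy'⟩
    have h := map_mem_closure hcont hxy (t := ⋃ n, Q n) (by
      rintro ⟨_, _⟩ ⟨⟨m, rfl⟩, ⟨n, rfl⟩⟩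
      refine mem_iUnion.2 ⟨max m n, _, smul_mem_smul_set (hPmono (le_max_left m n) (hdP m)),
        l • -d n, smul_mem_smul_set (neg_mem_neg.2 (hPmono (le_max_right m n) (hdP n))), ?_⟩
      simp [sub_eq_add_neg])
    simpa using h
  calc μ ((1 - l) • K + l • -K) ≤ μ (closure (⋃ n, Q n)) := measure_mono hsub
    _ = μ (⋃ n, Q n) := measure_closure_of_null_frontier (hQc.addHaar_frontier μ)
    _ = ⨆ n, μ (Q n) := hQmono.measure_iUnion
    _ ≤ _ := iSup_le fun n => (measure_polytope_unbalanced_difference_le μ hE _ hl0 hl1).trans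
      (by gcongr; exact hPK n)

end DimensionFour

theorem unbalanced_RS_dim4 (K : Set (EuclideanSpace ℝ (Fin 4)))
    (hK_compact : IsCompact K) (hK_conv : Convex ℝ K)
    (hK_int : (interior K).Nonempty)
    (lam : ℝ) (hlam : lam ∈ Set.Icc (0:ℝ) 1) :
    volume ((1 - lam) • K + lam • (-K))
      ≤ ENNReal.ofReal
          ((1 - lam)^4 + 16 * lam * (1 - lam)^3 + 36 * lam^2 * (1 - lam)^2
            + 16 * lam^3 * (1 - lam) + lam^4) * volume K := by
  have hne : K.Nonempty := hK_int.mono interior_subset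
  rcases hlam.1.eq_or_lt with rfl | h0
  · simp [zero_smul_set hne.neg]
  rcases hlam.2.eq_or_lt with rfl | h1
  · simp [zero_smul_set hne]
  · exact measure_unbalanced_difference_le volume (by simp) hK_conv hne h0 h1
end

section
/- Let K be a convex body in ℝⁿ containing the origin, and let λ ∈ [0,1]. Then vol(conv(((1−λ)K) ∪ (−λK))) ≤ vol(K). -/
open MeasureTheory Set Pointwise

open scoped ENNReal

section ExpGauge

variable {E : Type*} [NormedAddCommGroup E] [NormedSpace ℝ E]

/-- The function `exp (-‖x‖_K)`, where `‖·‖_K` is the gauge of `K` with the value `∞` allowed,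
written as the integral of `exp (-t)` over the `t > 0` with `x ∈ t • K`. -/
noncomputable def expGauge (K : Set E) (x : E) : ℝ≥0∞ :=
  ∫⁻ t in Ioi (0 : ℝ), ENNReal.ofReal (Real.exp (-t)) * K.indicator 1 (t⁻¹ • x)

lemma lintegral_exp_neg_Ioi (a : ℝ) :
    ∫⁻ t in Ioi a, ENNReal.ofReal (Real.exp (-t)) = ENNReal.ofReal (Real.exp (-a)) := by
  rw [← integral_exp_neg_Ioi a, ofReal_integral_eq_lintegral_ofReal (integrableOn_exp_neg_Ioi a)]
  exact Filter.Eventually.of_forall fun _ ↦ (Real.exp_pos _).le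

lemma le_expGauge_smul {K : Set E} (hK : Convex ℝ K) (h0 : (0 : E) ∈ K) {t : ℝ} (ht : 0 ≤ t)
    {k : E} (hk : k ∈ K) : ENNReal.ofReal (Real.exp (-t)) ≤ expGauge K (t • k) := by
  rw [← lintegral_exp_neg_Ioi t]
  refine le_trans (setLIntegral_mono' measurableSet_Ioi fun s hs ↦ ?_)
    (lintegral_mono_set (Ioi_subset_Ioi ht))
  have hs0 : 0 < s := ht.trans_lt hs
  have hmem : s⁻¹ • t • k ∈ K := by
    rw [smul_smul]
    refine hK.smul_mem_of_zero_mem h0 hk ⟨by positivity, ?_⟩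
    rw [inv_mul_le_iff₀ hs0, mul_one]
    exact (mem_Ioi.1 hs).le
  simp [hmem]

lemma expGauge_le {K : Set E} {x : E} {c : ℝ≥0∞}
    (h : ∀ s : ℝ, 0 < s → s⁻¹ • x ∈ K → ENNReal.ofReal (Real.exp (-s)) ≤ c) :
    expGauge K x ≤ c := by
  by_cases hc : c = ∞
  · simp [hc]
  lift c to NNReal using hc
  by_cases hne : ∃ s : ℝ, 0 < s ∧ s⁻¹ • x ∈ K
  · obtain ⟨s₀, hs₀, hx₀⟩ := hne
    have hexp : ∀ s : ℝ, 0 < s → s⁻¹ • x ∈ K → Real.exp (-s) ≤ c := fun s hs hx ↦ by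
      have := h s hs hx
      rwa [ENNReal.ofReal_le_coe] at this
    have hc : (0 : ℝ) < c := (Real.exp_pos _).trans_le (hexp s₀ hs₀ hx₀)
    have hle : expGauge K x ≤ ∫⁻ t in Ici (-Real.log c), ENNReal.ofReal (Real.exp (-t)) := by
      rw [expGauge, ← lintegral_indicator measurableSet_Ioi, ← lintegral_indicator measurableSet_Ici]
      refine lintegral_mono fun t ↦ ?_
      by_cases ht : t ∈ Ioi (0 : ℝ)
      · by_cases hx : t⁻¹ • x ∈ K
        · have : t ∈ Ici (-Real.log c) := by
            have := (Real.le_log_iff_exp_le hc).2 (hexp t ht hx)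
            rw [mem_Ici]
            linarith
          simp [indicator_of_mem, ht, this, hx]
        · simp [indicator_of_mem ht, hx]
      · simp only [indicator_of_notMem ht]
        exact zero_le
    rw [setLIntegral_congr Ioi_ae_eq_Ici.symm, lintegral_exp_neg_Ioi, neg_neg,
      Real.exp_log hc, ENNReal.ofReal_coe_nnreal] at hle
    exact hle
  · push Not at hne
    have : expGauge K x = 0 := by
      rw [expGauge, ← lintegral_zero (μ := volume.restrict (Ioi (0 : ℝ)))]
      exact setLIntegral_congr_fun measurableSet_Ioi fun t ht ↦ by simp [hne t ht]
    simp [this]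

lemma expGauge_mul_le {K : Set E} {x : E} {c d : ℝ≥0∞} (hd : d ≠ 0) (hd' : d ≠ ∞)
    (h : ∀ s : ℝ, 0 < s → s⁻¹ • x ∈ K → ENNReal.ofReal (Real.exp (-s)) * d ≤ c) :
    expGauge K x * d ≤ c := by
  rw [← ENNReal.le_div_iff_mul_le (.inl hd) (.inl hd')]
  refine expGauge_le fun s hs hx ↦ ?_
  rw [ENNReal.le_div_iff_mul_le (.inl hd) (.inl hd')]
  exact h s hs hx

lemma expGauge_le_one (K : Set E) (x : E) : expGauge K x ≤ 1 :=
  expGauge_le fun s hs _ ↦ by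
    rw [ENNReal.ofReal_le_one, Real.exp_le_one_iff]
    linarith

lemma expGauge_mul_le_add {K : Set E} (hK : Convex ℝ K) (h0 : (0 : E) ∈ K) (x y : E) :
    expGauge K x * expGauge K y ≤ expGauge K (x + y) := by
  by_cases hy : expGauge K y = 0
  · simp [hy]
  refine expGauge_mul_le hy ((expGauge_le_one K y).trans_lt ENNReal.one_lt_top).ne
    fun s hs hx ↦ ?_
  rw [mul_comm]
  refine expGauge_mul_le (by simp [Real.exp_pos]) ENNReal.ofReal_ne_top fun r hr hy ↦ ?_
  have hxy : x + y = (s + r) • ((s / (s + r)) • s⁻¹ • x + (r / (s + r)) • r⁻¹ • y) := by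
    simp only [smul_add, smul_smul]
    congr 1
    · rw [show (s + r) * (s / (s + r) * s⁻¹) = 1 by field_simp, one_smul]
    · rw [show (s + r) * (r / (s + r) * r⁻¹) = 1 by field_simp, one_smul]
  rw [hxy, ← ENNReal.ofReal_mul (Real.exp_pos _).le, ← Real.exp_add,
    show -r + -s = -(s + r) by ring]
  exact le_expGauge_smul hK h0 (by positivity)
    (hK hx hy (by positivity) (by positivity) (by field_simp))

lemma expGauge_le_mul {K L M : Set E} (hK : Convex ℝ K) (hL : Convex ℝ L) (hK0 : (0 : E) ∈ K)
    (hL0 : (0 : E) ∈ L)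
    (hM : ∀ m ∈ M, ∃ a b : ℝ, 0 ≤ a ∧ 0 ≤ b ∧ a + b = 1 ∧ m ∈ a • K ∧ m ∈ b • L) (x : E) :
    expGauge M x ≤ expGauge K x * expGauge L x := by
  refine expGauge_le fun s hs hx ↦ ?_
  obtain ⟨a, b, ha, hb, hab, ⟨k, hk, hk'⟩, ⟨l, hl, hl'⟩⟩ := hM _ hx
  have hxk : x = (s * a) • k := by
    rw [mul_smul, ← smul_inv_smul₀ hs.ne' x]
    exact congrArg _ hk'.symm
  have hxl : x = (s * b) • l := by
    rw [mul_smul, ← smul_inv_smul₀ hs.ne' x]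
    exact congrArg _ hl'.symm
  calc ENNReal.ofReal (Real.exp (-s))
      = ENNReal.ofReal (Real.exp (-(s * a))) * ENNReal.ofReal (Real.exp (-(s * b))) := by
        rw [← ENNReal.ofReal_mul (Real.exp_pos _).le, ← Real.exp_add]
        congr 2
        linear_combination s * hab
    _ ≤ expGauge K x * expGauge L x := by
        gcongr
        · rw [hxk]
          exact le_expGauge_smul hK hK0 (by positivity) hk
        · rw [hxl]
          exact le_expGauge_smul hL hL0 (by positivity) hl

variable [MeasurableSpace E] [BorelSpace E] [FiniteDimensional ℝ E]

lemma measurable_expGauge_integrand {K : Set E} (hK : MeasurableSet K) :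
    Measurable fun p : E × ℝ ↦
      ENNReal.ofReal (Real.exp (-p.2)) * K.indicator (1 : E → ℝ≥0∞) (p.2⁻¹ • p.1) := by
  have h : Measurable (K.indicator (1 : E → ℝ≥0∞)) := measurable_one.indicator hK
  have h' : Measurable fun p : E × ℝ ↦ p.2⁻¹ • p.1 := by fun_prop
  exact Measurable.mul (by fun_prop) (h.comp h')

lemma measurable_expGauge {K : Set E} (hK : MeasurableSet K) : Measurable (expGauge K) :=
  (measurable_expGauge_integrand hK).lintegral_prod_right'

variable (μ : Measure E) [μ.IsAddHaarMeasure]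

lemma lintegral_expGauge {K : Set E} (hK : MeasurableSet K) :
    ∫⁻ x, expGauge K x ∂μ =
      ENNReal.ofReal (Real.Gamma (Module.finrank ℝ E + 1)) * μ K := by
  simp only [expGauge]
  rw [lintegral_lintegral_swap (measurable_expGauge_integrand hK).aemeasurable]
  have hinner : ∀ t ∈ Ioi (0 : ℝ),
      ∫⁻ x, ENNReal.ofReal (Real.exp (-t)) * K.indicator (1 : E → ℝ≥0∞) (t⁻¹ • x) ∂μ
        = ENNReal.ofReal (Real.exp (-t) * t ^ ((Module.finrank ℝ E + 1 : ℝ) - 1)) * μ K := by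
    intro t ht
    have ht : 0 < t := ht
    have hind : (fun x ↦ K.indicator (1 : E → ℝ≥0∞) (t⁻¹ • x)) = (t • K).indicator 1 := by
      ext x
      by_cases hx : t⁻¹ • x ∈ K
      · simp [hx, (mem_smul_set_iff_inv_smul_mem₀ ht.ne' K x).2 hx]
      · simp [hx, mt (mem_smul_set_iff_inv_smul_mem₀ ht.ne' K x).1 hx]
    rw [lintegral_const_mul' _ _ ENNReal.ofReal_ne_top, hind,
      lintegral_indicator_one (hK.const_smul₀ t), Measure.addHaar_smul, ← mul_assoc,
      ← ENNReal.ofReal_mul (Real.exp_pos _).le, abs_of_nonneg (by positivity),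
      add_sub_cancel_right, Real.rpow_natCast]
  have hn : (0 : ℝ) < Module.finrank ℝ E + 1 := by positivity
  rw [setLIntegral_congr_fun measurableSet_Ioi hinner,
    lintegral_mul_const _ (by fun_prop), Real.Gamma_eq_integral hn,
    ofReal_integral_eq_lintegral_ofReal (Real.GammaIntegral_convergent hn)]
  filter_upwards [self_mem_ae_restrict measurableSet_Ioi] with t ht
  have : (0 : ℝ) < t := ht
  positivity

/-- The Rogers–Shephard inequality for `convexHull ℝ (K ∪ -L)`: here `M` is contained in the
unit ball of the sum of the gauges of `K` and `L`. -/
theorem measure_convexHull_union_neg_mul_le {K L M : Set E} (hK : Convex ℝ K) (hL : Convex ℝ L)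
    (hKc : IsCompact K) (hLc : IsCompact L) (hMm : MeasurableSet M)
    (hK0 : (0 : E) ∈ K) (hL0 : (0 : E) ∈ L)
    (hM : ∀ m ∈ M, ∃ a b : ℝ, 0 ≤ a ∧ 0 ≤ b ∧ a + b = 1 ∧ m ∈ a • K ∧ m ∈ b • L) :
    μ (convexHull ℝ (K ∪ -L)) * μ M ≤ μ K * μ L := by
  set A := convexHull ℝ (K ∪ -L) with hA
  have hA_mem : ∀ z ∈ A, ∃ a b : ℝ, 0 ≤ a ∧ 0 ≤ b ∧ a + b = 1 ∧
      ∃ k ∈ K, ∃ l ∈ L, a • k - b • l = z := by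
    intro z hz
    rw [hA, hK.convexHull_union hL.neg ⟨0, hK0⟩ ⟨0, by simpa using hL0⟩, mem_convexJoin] at hz
    obtain ⟨k, hk, l, hl, a, b, ha, hb, hab, rfl⟩ := hz
    exact ⟨a, b, ha, hb, hab, k, hk, -l, hl, by simp⟩
  have hAm : MeasurableSet A := by
    have himage : A = (fun p : ℝ × E × E ↦ p.1 • p.2.1 - (1 - p.1) • p.2.2) ''
        (Icc 0 1 ×ˢ K ×ˢ L) := by
      ext z
      constructor
      · intro hz
        obtain ⟨a, b, ha, hb, hab, k, hk, l, hl, rfl⟩ := hA_mem z hz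
        refine ⟨(a, k, l), ⟨⟨ha, by linarith⟩, hk, hl⟩, ?_⟩
        simp [← hab]
      · rintro ⟨⟨a, k, l⟩, ⟨⟨ha, ha'⟩, hk, hl⟩, rfl⟩
        have := convex_convexHull ℝ (K ∪ -L) (subset_convexHull ℝ _ (.inl hk))
          (subset_convexHull ℝ _ (.inr (show -l ∈ -L by simpa using hl))) ha
          (sub_nonneg.2 ha') (by ring)
        simpa [sub_eq_add_neg] using this
    rw [himage]
    exact ((isCompact_Icc.prod (hKc.prod hLc)).image (by fun_prop)).measurableSet
  have hF := measurable_expGauge hKc.measurableSet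
  have hG := measurable_expGauge hLc.measurableSet
  have hfiber : ∀ z, expGauge A z * ∫⁻ x, expGauge M x ∂μ ≤
      ∫⁻ x, expGauge K x * expGauge L (x - z) ∂μ := by
    intro z
    by_cases hC : ∫⁻ x, expGauge M x ∂μ = 0
    · simp [hC]
    have hC' : ∫⁻ x, expGauge M x ∂μ ≠ ∞ := by
      refine ne_top_of_le_ne_top ?_ (lintegral_mono fun x ↦
        (expGauge_le_mul hK hL hK0 hL0 hM x).trans (mul_le_of_le_one_right' (expGauge_le_one L x)))
      rw [lintegral_expGauge μ hKc.measurableSet]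
      exact ENNReal.mul_ne_top ENNReal.ofReal_ne_top hKc.measure_ne_top
    refine expGauge_mul_le hC hC' fun s hs hz ↦ ?_
    obtain ⟨a, b, ha, hb, hab, k, hk, l, hl, hkl⟩ := hA_mem _ hz
    have hz : (s * a) • k - z = (s * b) • l := by
      rw [← smul_inv_smul₀ hs.ne' z, ← hkl, smul_sub, smul_smul, smul_smul, sub_sub_cancel]
    rw [← lintegral_const_mul' _ _ ENNReal.ofReal_ne_top,
      ← lintegral_add_right_eq_self
        (fun x ↦ expGauge K x * expGauge L (x - z)) ((s * a) • k)]
    refine lintegral_mono fun x ↦ ?_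
    rw [add_sub_assoc, hz]
    calc ENNReal.ofReal (Real.exp (-s)) * expGauge M x
        ≤ (ENNReal.ofReal (Real.exp (-(s * a))) * ENNReal.ofReal (Real.exp (-(s * b)))) *
          (expGauge K x * expGauge L x) := by
          rw [← ENNReal.ofReal_mul (Real.exp_pos _).le, ← Real.exp_add,
            show -(s * a) + -(s * b) = -s by linear_combination -s * hab]
          gcongr
          exact expGauge_le_mul hK hL hK0 hL0 hM x
      _ ≤ (expGauge K ((s * a) • k) * expGauge L ((s * b) • l)) *
          (expGauge K x * expGauge L x) := by
          gcongr
          · exact le_expGauge_smul hK hK0 (by positivity) hk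
          · exact le_expGauge_smul hL hL0 (by positivity) hl
      _ = (expGauge K x * expGauge K ((s * a) • k)) *
          (expGauge L x * expGauge L ((s * b) • l)) := by ring
      _ ≤ _ := by
          gcongr
          · exact expGauge_mul_le_add hK hK0 _ _
          · exact expGauge_mul_le_add hL hL0 _ _
  set c := ENNReal.ofReal (Real.Gamma (Module.finrank ℝ E + 1)) with hc
  have hc0 : c ≠ 0 := by
    rw [hc, Ne, ENNReal.ofReal_eq_zero, not_le]
    exact Real.Gamma_pos_of_pos (by positivity)
  have hctop : c ≠ ∞ := ENNReal.ofReal_ne_top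
  have hsub : ∀ x, ∫⁻ z, expGauge L (x - z) ∂μ = c * μ L := fun x ↦ by
    rw [lintegral_sub_left_eq_self (expGauge L) x, lintegral_expGauge μ hLc.measurableSet]
  have hmeas : Measurable fun p : E × E ↦ expGauge K p.2 * expGauge L (p.2 - p.1) := by
    fun_prop
  have key : c * μ A * (c * μ M) ≤ c * μ K * (c * μ L) := by
    calc c * μ A * (c * μ M) = ∫⁻ z, expGauge A z * ∫⁻ x, expGauge M x ∂μ ∂μ := by
          rw [lintegral_mul_const _ (measurable_expGauge hAm), lintegral_expGauge μ hAm,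
            lintegral_expGauge μ hMm]
      _ ≤ ∫⁻ z, ∫⁻ x, expGauge K x * expGauge L (x - z) ∂μ ∂μ := lintegral_mono hfiber
      _ = ∫⁻ x, ∫⁻ z, expGauge K x * expGauge L (x - z) ∂μ ∂μ :=
          lintegral_lintegral_swap hmeas.aemeasurable
      _ = c * μ K * (c * μ L) := by
          simp_rw [fun x ↦ lintegral_const_mul' (μ := μ) (expGauge K x)
            (fun z ↦ expGauge L (x - z)) ((expGauge_le_one K x).trans_lt ENNReal.one_lt_top).ne,
            hsub]
          rw [lintegral_mul_const _ hF, lintegral_expGauge μ hKc.measurableSet]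
  rw [mul_mul_mul_comm, mul_mul_mul_comm c (μ K)] at key
  exact (ENNReal.mul_le_mul_iff_right (mul_ne_zero hc0 hc0) (ENNReal.mul_ne_top hctop hctop)).1 key

end ExpGauge

theorem volume_conv_union_neg_le (n : ℕ)
    (K : Set (EuclideanSpace ℝ (Fin n)))
    (hK_compact : IsCompact K) (hK_conv : Convex ℝ K)
    (hK_int : (interior K).Nonempty) (hK0 : (0 : EuclideanSpace ℝ (Fin n)) ∈ K)
    (lam : ℝ) (hlam : lam ∈ Set.Icc (0:ℝ) 1) :
    volume (convexHull ℝ (((1 - lam) • K) ∪ -(lam • K))) ≤ volume K := by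
  obtain ⟨hl0, hl1⟩ := hlam
  rcases hl0.eq_or_lt with rfl | hl0
  · rw [sub_zero, one_smul, zero_smul_set ⟨0, hK0⟩, neg_zero,
      union_eq_left.2 (by simpa using hK0), hK_conv.convexHull_eq]
  rcases hl1.eq_or_lt with rfl | hl1
  · rw [sub_self, one_smul, zero_smul_set ⟨0, hK0⟩,
      union_eq_right.2 (by simpa using hK0), hK_conv.neg.convexHull_eq, Measure.measure_neg]
  have hl1 : 0 < 1 - lam := sub_pos.2 hl1
  have h := measure_convexHull_union_neg_mul_le volume (hK_conv.smul (1 - lam))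
    (hK_conv.smul lam) (hK_compact.smul (1 - lam)) (hK_compact.smul lam)
    (hK_compact.smul (lam * (1 - lam))).measurableSet
    ⟨0, hK0, smul_zero _⟩ ⟨0, hK0, smul_zero _⟩ fun m hm ↦
      ⟨lam, 1 - lam, hl0.le, hl1.le, by ring, by rwa [smul_smul],
        by rwa [smul_smul, mul_comm (1 - lam)]⟩
  have hK_pos : volume K ≠ 0 := (Measure.measure_pos_of_nonempty_interior _ hK_int).ne'
  have hc : 0 < (lam * (1 - lam)) ^ n := by positivity
  simp only [Measure.addHaar_smul, finrank_euclideanSpace_fin] at h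
  rw [abs_of_pos hc, mul_mul_mul_comm, ← ENNReal.ofReal_mul (abs_nonneg _), ← abs_mul, ← mul_pow,
    mul_comm (1 - lam), abs_of_pos hc, mul_left_comm] at h
  have h := (ENNReal.mul_le_mul_iff_right (by simpa using hc) ENNReal.ofReal_ne_top).1 h
  exact (ENNReal.mul_le_mul_iff_left hK_pos hK_compact.measure_ne_top).1 h
end

section
/- Let K be a convex body in ℝⁿ. Then ∫₀¹ ∫₀¹ vol((1−η)(1−λ)K + η(−λK)) dη dλ ≤ vol(K)/(n+1), where the inner integrand is the volume of the Minkowski sum (1−η)(1−λ)K + η(λ(−K)). -/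
open MeasureTheory Set Pointwise

section Gamma

lemma lintegral_Ioi_exp_neg_mul_pow (m : ℕ) :
    ∫⁻ x in Ioi (0 : ℝ), ENNReal.ofReal (Real.exp (-x) * x ^ m) = (m.factorial : ENNReal) := by
  have hpos : (0 : ℝ) < m + 1 := by positivity
  have hint := Real.GammaIntegral_convergent hpos
  have hval := Real.Gamma_eq_integral hpos
  simp only [add_sub_cancel_right, Real.rpow_natCast] at hint hval
  rw [← ofReal_integral_eq_lintegral_ofReal hint, ← hval, Real.Gamma_nat_eq_factorial,
    ENNReal.ofReal_natCast]
  refine (ae_restrict_iff' measurableSet_Ioi).2 (Filter.Eventually.of_forall fun x hx => ?_)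
  have : (0 : ℝ) < x := hx
  simp only [Pi.zero_apply]
  positivity

lemma lintegral_Ici_exp_neg (a : ℝ) :
    ∫⁻ x in Ici a, ENNReal.ofReal (Real.exp (-x)) = ENNReal.ofReal (Real.exp (-a)) := by
  rw [setLIntegral_congr Ioi_ae_eq_Ici.symm, ← integral_exp_neg_Ioi a]
  exact (ofReal_integral_eq_lintegral_ofReal (integrableOn_exp_neg_Ioi a)
    (Filter.Eventually.of_forall fun x => (Real.exp_pos _).le)).symm

/-- If `B` dominates `exp (-s) * M` at every `s ∈ S`, it dominates the exponential mass of `S`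
times `M`. -/
lemma lintegral_exp_neg_mul_le_of_forall_mem {S : Set ℝ} (hS : BddBelow S) {M B : ENNReal}
    (hM : M ≠ ⊤) (h : ∀ s ∈ S, ENNReal.ofReal (Real.exp (-s)) * M ≤ B) :
    (∫⁻ s in S, ENNReal.ofReal (Real.exp (-s))) * M ≤ B := by
  rcases S.eq_empty_or_nonempty with rfl | hne
  · simp
  obtain ⟨u, -, hu, huS⟩ := exists_seq_tendsto_sInf hne hS
  have hle : ∫⁻ s in S, ENNReal.ofReal (Real.exp (-s)) ≤ ENNReal.ofReal (Real.exp (-sInf S)) := by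
    rw [← lintegral_Ici_exp_neg]
    exact lintegral_mono_set fun s hs => csInf_le hS hs
  refine (mul_le_mul_left hle M).trans ?_
  have hlim : Filter.Tendsto (fun k => ENNReal.ofReal (Real.exp (-u k)) * M) Filter.atTop
      (nhds (ENNReal.ofReal (Real.exp (-sInf S)) * M)) :=
    ENNReal.Tendsto.mul_const
      (ENNReal.tendsto_ofReal ((Real.continuous_exp.tendsto _).comp hu.neg)) (Or.inr hM)
  exact le_of_tendsto' hlim fun k => h _ (huS k)

end Gamma

section Convolution

variable {V : Type*} [AddCommGroup V] [Module ℝ V] [MeasurableSpace V] [MeasurableAdd₂ V]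
  [MeasurableSub₂ V] [MeasurableConstSMul ℝ V]

/-- A sheared form of the fact that the integral of a convolution is the product of the
integrals. -/
lemma lintegral_lintegral_shear_mul (ν : Measure V) [SFinite ν] [ν.IsAddLeftInvariant]
    {H : V → ENNReal} (hH : Measurable H) (c : ℝ) :
    ∫⁻ y, ∫⁻ q, H (y + c • q) * H (q - (y + c • q)) ∂ν ∂ν = (∫⁻ x, H x ∂ν) * ∫⁻ x, H x ∂ν := by
  rw [lintegral_lintegral_swap (by
    refine Measurable.aemeasurable ?_
    have h1 : Measurable fun p : V × V => p.1 + c • p.2 :=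
      measurable_fst.add (measurable_snd.const_smul c)
    exact (hH.comp h1).mul (hH.comp (measurable_snd.sub h1)))]
  have h1 : ∀ q, ∫⁻ y, H (y + c • q) * H (q - (y + c • q)) ∂ν = ∫⁻ y, H y * H (q - y) ∂ν :=
    fun q => lintegral_add_right_eq_self (fun y => H y * H (q - y)) (c • q)
  simp_rw [h1]
  rw [lintegral_lintegral_swap (by
    refine Measurable.aemeasurable ?_
    exact (hH.comp measurable_snd).mul (hH.comp (measurable_fst.sub measurable_snd)))]
  have h2 : ∀ y, ∫⁻ q, H y * H (q - y) ∂ν = H y * ∫⁻ q, H q ∂ν := fun y => by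
    rw [lintegral_const_mul _ (f := fun q => H (q - y)) (hH.comp (measurable_id.sub_const y)),
      lintegral_sub_right_eq_self]
  simp_rw [h2]
  rw [lintegral_mul_const _ hH]

end Convolution

section ConvexBody

variable {E : Type*} [NormedAddCommGroup E] [NormedSpace ℝ E]

/-- The cone over `K` placed at height one. -/
def coneOver (K : Set E) : Set (ℝ × E) := {p | 0 ≤ p.1 ∧ p.2 ∈ p.1 • K}

/-- Pairs `(s, y)` with `y = (1 - c) • p - c • q` for points `p`, `q` of the cone over `K` whose
heights sum to `s`. -/
def coneDiff (K : Set E) (c : ℝ) : Set (ℝ × (ℝ × E)) :=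
  (fun x : (ℝ × E) × (ℝ × E) => (x.1.1 + x.2.1, (1 - c) • x.1 - c • x.2)) ''
    coneOver K ×ˢ coneOver K

lemma coneOver_add_mem {K : Set E} (hK : Convex ℝ K) {p q : ℝ × E}
    (hp : p ∈ coneOver K) (hq : q ∈ coneOver K) : p + q ∈ coneOver K := by
  refine ⟨add_nonneg hp.1 hq.1, ?_⟩
  rw [Prod.fst_add, hK.add_smul hp.1 hq.1]
  exact add_mem_add hp.2 hq.2

lemma coneOver_smul_mem {K : Set E} {p : ℝ × E} (hp : p ∈ coneOver K) {t : ℝ} (ht : 0 ≤ t) :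
    t • p ∈ coneOver K := by
  refine ⟨mul_nonneg ht hp.1, ?_⟩
  obtain ⟨k, hk, hkp⟩ := hp.2
  refine ⟨k, hk, ?_⟩
  simp only [Prod.smul_fst, Prod.smul_snd, smul_eq_mul, ← hkp, smul_smul]

lemma isSigmaCompact_coneOver {K : Set E} (hK : IsCompact K) : IsSigmaCompact (coneOver K) := by
  have h : coneOver K = ⋃ m : ℕ, (fun x : ℝ × E => (x.1, x.1 • x.2)) '' Icc (0 : ℝ) m ×ˢ K := by
    ext ⟨a, u⟩
    simp only [coneOver, mem_ofPred_eq, mem_iUnion, mem_image, mem_prod, Prod.exists, Prod.mk.injEq,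
      mem_Icc, mem_smul_set]
    constructor
    · rintro ⟨ha, k, hk, rfl⟩
      obtain ⟨m, hm⟩ := exists_nat_ge a
      exact ⟨m, a, k, ⟨⟨ha, hm⟩, hk⟩, rfl, rfl⟩
    · rintro ⟨m, b, k, ⟨⟨hb, -⟩, hk⟩, rfl, rfl⟩
      exact ⟨hb, k, hk, rfl⟩
  rw [h]
  exact isSigmaCompact_iUnion_of_isCompact _ fun m =>
    (isCompact_Icc.prod hK).image (by fun_prop)

lemma IsSigmaCompact.setProd {X Y : Type*} [TopologicalSpace X] [TopologicalSpace Y] {s : Set X}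
    {t : Set Y} (hs : IsSigmaCompact s) (ht : IsSigmaCompact t) : IsSigmaCompact (s ×ˢ t) := by
  obtain ⟨f, hf, rfl⟩ := hs
  obtain ⟨g, hg, rfl⟩ := ht
  rw [iUnion_prod_const]
  simp_rw [prod_iUnion]
  exact isSigmaCompact_iUnion _ fun i =>
    isSigmaCompact_iUnion_of_isCompact _ fun j => (hf i).prod (hg j)

lemma IsSigmaCompact.measurableSet_of_t2 {X : Type*} [TopologicalSpace X] [T2Space X]
    [MeasurableSpace X] [OpensMeasurableSpace X] {s : Set X} (hs : IsSigmaCompact s) :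
    MeasurableSet s := by
  obtain ⟨f, hf, rfl⟩ := hs
  exact MeasurableSet.iUnion fun i => (hf i).measurableSet

lemma isSigmaCompact_coneDiff {K : Set E} (hK : IsCompact K) (c : ℝ) :
    IsSigmaCompact (coneDiff K c) :=
  ((isSigmaCompact_coneOver hK).setProd (isSigmaCompact_coneOver hK)).image (by fun_prop)

variable [FiniteDimensional ℝ E] [MeasurableSpace E] [BorelSpace E] (μ : Measure E)
  [μ.IsAddHaarMeasure]

/-- The exponential density on the cone over `K`. -/
noncomputable def coneDensity (K : Set E) : ℝ × E → ENNReal :=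
  (coneOver K).indicator fun p => ENNReal.ofReal (Real.exp (-p.1))

lemma measurable_coneDensity {K : Set E} (hK : IsCompact K) : Measurable (coneDensity K) :=
  Measurable.indicator (by fun_prop) (isSigmaCompact_coneOver hK).measurableSet_of_t2

lemma lintegral_coneDensity {K : Set E} (hK : IsCompact K) :
    ∫⁻ p, coneDensity K p ∂(volume.prod μ)
      = ((Module.finrank ℝ E).factorial : ENNReal) * μ K := by
  rw [lintegral_prod _ (measurable_coneDensity hK).aemeasurable,
    ← lintegral_Ioi_exp_neg_mul_pow, ← lintegral_mul_const _ (by fun_prop),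
    setLIntegral_congr Ioi_ae_eq_Ici, ← lintegral_indicator measurableSet_Ici]
  refine lintegral_congr fun a => ?_
  by_cases ha : 0 ≤ a
  · have h : ∀ u, coneDensity K (a, u)
        = (a • K).indicator (fun _ => ENNReal.ofReal (Real.exp (-a))) u := fun u => by
      simp only [coneDensity, coneOver, indicator, mem_ofPred_eq]
      congr 1
      exact propext (and_iff_right ha)
    simp_rw [h]
    rw [lintegral_indicator (hK.smul a).measurableSet, setLIntegral_const,
      Measure.addHaar_smul_of_nonneg μ ha, indicator_of_mem (mem_Ici.2 ha),
      ENNReal.ofReal_mul (Real.exp_pos _).le, mul_assoc]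
  · simp [coneDensity, coneOver, ha]

/-- Every line of `coneDiff K c` in the first coordinate has exponential mass controlled by the
sheared convolution of the cone density. -/
lemma lintegral_coneDiff_line_le {K : Set E} (hKc : IsCompact K) (hK : Convex ℝ K) {c : ℝ}
    (hc0 : 0 ≤ c) (hc1 : c ≤ 1) (y : ℝ × E) :
    (∫⁻ s in (fun s => (s, y)) ⁻¹' coneDiff K c, ENNReal.ofReal (Real.exp (-s))) *
        ∫⁻ p, coneDensity K p ∂(volume.prod μ)
      ≤ ∫⁻ q, coneDensity K (y + c • q) * coneDensity K (q - (y + c • q)) ∂(volume.prod μ) := by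
  refine lintegral_exp_neg_mul_le_of_forall_mem ⟨0, ?_⟩ ?_ ?_
  · rintro s ⟨⟨p, q⟩, ⟨hp, hq⟩, h⟩
    rw [Prod.mk.injEq] at h
    exact h.1 ▸ add_nonneg hp.1 hq.1
  · rw [lintegral_coneDensity μ hKc]
    exact ENNReal.mul_ne_top (ENNReal.natCast_ne_top _) hKc.measure_lt_top.ne
  · rintro s ⟨⟨p, q⟩, ⟨hp, hq⟩, h⟩
    simp only [Prod.mk.injEq] at h
    obtain ⟨rfl, rfl⟩ := h
    rw [← lintegral_const_mul _ (measurable_coneDensity hKc)]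
    rw [← lintegral_add_left_eq_self (fun x => coneDensity K _ * coneDensity K _) (p + q)]
    refine lintegral_mono fun r => ?_
    by_cases hr : r ∈ coneOver K
    · have e1 : (1 - c) • p - c • q + c • (p + q + r) = p + c • r := by module
      have e2 : p + q + r - (p + c • r) = q + (1 - c) • r := by module
      have h1 : p + c • r ∈ coneOver K := coneOver_add_mem hK hp (coneOver_smul_mem hr hc0)
      have h2 : q + (1 - c) • r ∈ coneOver K :=
        coneOver_add_mem hK hq (coneOver_smul_mem hr (sub_nonneg.2 hc1))
      simp only [e1, e2, coneDensity, indicator_of_mem h1, indicator_of_mem h2,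
        indicator_of_mem hr]
      rw [← ENNReal.ofReal_mul (Real.exp_pos _).le, ← ENNReal.ofReal_mul (Real.exp_pos _).le,
        ← Real.exp_add, ← Real.exp_add]
      refine le_of_eq (congrArg _ (congrArg _ ?_))
      simp only [Prod.fst_add, Prod.smul_fst, smul_eq_mul]
      ring
    · simp [coneDensity, hr]

lemma lintegral_exp_neg_mul_measure_coneDiff_le {K : Set E} (hKc : IsCompact K)
    (hK : Convex ℝ K) (hK0 : μ K ≠ 0) {c : ℝ} (hc0 : 0 ≤ c) (hc1 : c ≤ 1) :
    ∫⁻ s, ENNReal.ofReal (Real.exp (-s)) * (volume.prod μ) (Prod.mk s ⁻¹' coneDiff K c)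
      ≤ ((Module.finrank ℝ E).factorial : ENNReal) * μ K := by
  have hD := (isSigmaCompact_coneDiff hKc c).measurableSet_of_t2
  set M := ∫⁻ p, coneDensity K p ∂(volume.prod μ) with hM
  have hM' := lintegral_coneDensity μ hKc
  rw [← hM] at hM'
  have hMtop : M ≠ ⊤ := by
    rw [hM']; exact ENNReal.mul_ne_top (ENNReal.natCast_ne_top _) hKc.measure_lt_top.ne
  have hM0 : M ≠ 0 := by
    rw [hM']; exact mul_ne_zero (by exact_mod_cast (Nat.factorial_pos _).ne') hK0
  rw [← hM', ← ENNReal.mul_le_mul_iff_left hM0 hMtop,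
    ← lintegral_lintegral_shear_mul _ (measurable_coneDensity hKc) c]
  refine le_trans (le_of_eq ?_)
    (lintegral_mono fun y => lintegral_coneDiff_line_le μ hKc hK hc0 hc1 y)
  rw [lintegral_mul_const' _ _ hMtop]
  congr 1
  have hmeas : Measurable fun x : ℝ × (ℝ × E) =>
      (coneDiff K c).indicator (fun x => ENNReal.ofReal (Real.exp (-x.1))) x :=
    Measurable.indicator (by fun_prop) hD
  trans ∫⁻ s, ∫⁻ y, (coneDiff K c).indicator
      (fun x => ENNReal.ofReal (Real.exp (-x.1))) (s, y) ∂(volume.prod μ)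
  · refine lintegral_congr fun s => ?_
    rw [← setLIntegral_const, ← lintegral_indicator (measurable_prodMk_left hD)]
    rfl
  · rw [lintegral_lintegral_swap hmeas.aemeasurable]
    refine lintegral_congr fun y => ?_
    rw [← lintegral_indicator (measurable_prodMk_right hD)]
    rfl

lemma lintegral_comp_mul_one_sub {s : ℝ} (hs : 0 < s) (f : ℝ → ENNReal) :
    ENNReal.ofReal s * ∫⁻ t, f (s * (1 - t)) = ∫⁻ x, f x := by
  rw [lintegral_sub_left_eq_self (fun t => f (s * t)) 1]
  conv_rhs => rw [← Real.smul_map_volume_mul_left hs.ne', lintegral_smul_measure, abs_of_pos hs]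
  rw [smul_eq_mul]
  congr 1
  exact (lintegral_map_equiv f (Homeomorph.mulLeft₀ s hs.ne').toMeasurableEquiv).symm

lemma lintegral_measure_smul_add_smul_neg_le_measure_coneDiff {K : Set E} (hKc : IsCompact K)
    (c : ℝ) {s : ℝ} (hs : 0 < s) :
    ENNReal.ofReal (s ^ (Module.finrank ℝ E + 1)) *
        ∫⁻ η in Icc (0 : ℝ) 1, μ ((1 - η) • ((1 - c) • K) + η • (c • (-K)))
      ≤ (volume.prod μ) (Prod.mk s ⁻¹' coneDiff K c) := by
  have hD := (isSigmaCompact_coneDiff hKc c).measurableSet_of_t2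
  rw [Measure.prod_apply (measurable_prodMk_left hD),
    ← lintegral_sub_right_eq_self (μ := (volume : Measure ℝ))
      (fun a => μ (Prod.mk a ⁻¹' (Prod.mk s ⁻¹' coneDiff K c))) (c * s), ← lintegral_comp_mul_one_sub hs,
    pow_succ', ENNReal.ofReal_mul hs.le, mul_assoc, ← lintegral_indicator measurableSet_Icc,
    ← lintegral_const_mul' _ _ ENNReal.ofReal_ne_top]
  gcongr with η
  by_cases hη : η ∈ Icc (0 : ℝ) 1
  · rw [indicator_of_mem hη, ← Measure.addHaar_smul_of_nonneg μ hs.le]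
    refine measure_mono ?_
    rintro _ ⟨_, ⟨_, ⟨_, ⟨k, hk, rfl⟩, rfl⟩, _, ⟨_, ⟨l, hl, rfl⟩, rfl⟩, rfl⟩, rfl⟩
    refine ⟨((s * (1 - η), (s * (1 - η)) • k), (s * η, (s * η) • (-l))),
      ⟨⟨mul_nonneg hs.le (sub_nonneg.2 hη.2), k, hk, rfl⟩,
        ⟨mul_nonneg hs.le hη.1, -l, hl, rfl⟩⟩, ?_⟩
    simp only [Prod.mk.injEq, Prod.smul_mk, Prod.mk_sub_mk, smul_eq_mul]
    refine ⟨by ring, by ring, by module⟩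
  · simp [indicator_of_notMem hη]

theorem lintegral_measure_smul_add_smul_neg_le {K : Set E} (hKc : IsCompact K)
    (hK : Convex ℝ K) (hK0 : μ K ≠ 0) {c : ℝ} (hc0 : 0 ≤ c) (hc1 : c ≤ 1) :
    ∫⁻ η in Icc (0 : ℝ) 1, μ ((1 - η) • ((1 - c) • K) + η • (c • (-K)))
      ≤ μ K / (Module.finrank ℝ E + 1) := by
  set n := Module.finrank ℝ E with hn
  set I := ∫⁻ η in Icc (0 : ℝ) 1, μ ((1 - η) • ((1 - c) • K) + η • (c • (-K))) with hI
  have key : ((n + 1).factorial : ENNReal) * I ≤ (n.factorial : ENNReal) * μ K := by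
    refine le_trans ?_ (lintegral_exp_neg_mul_measure_coneDiff_le μ hKc hK hK0 hc0 hc1)
    rw [← lintegral_Ioi_exp_neg_mul_pow, ← lintegral_mul_const _ (by fun_prop)]
    refine le_trans (setLIntegral_mono' measurableSet_Ioi fun s hs => ?_)
      (setLIntegral_le_lintegral (Ioi 0) _)
    rw [ENNReal.ofReal_mul (Real.exp_pos _).le, mul_assoc]
    gcongr
    exact lintegral_measure_smul_add_smul_neg_le_measure_coneDiff μ hKc c hs
  have hf0 : (n.factorial : ENNReal) ≠ 0 := by exact_mod_cast (Nat.factorial_pos _).ne'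
  rw [ENNReal.le_div_iff_mul_le (Or.inl (by simp)) (Or.inl (by simp)),
    ← ENNReal.mul_le_mul_iff_right hf0 (ENNReal.natCast_ne_top _)]
  refine le_trans (le_of_eq ?_) key
  rw [Nat.factorial_succ]
  push_cast
  ring

end ConvexBody

theorem godbersen_average_form (n : ℕ) (K : Set (EuclideanSpace ℝ (Fin n)))
    (hK_compact : IsCompact K) (hK_conv : Convex ℝ K)
    (hK_int : (interior K).Nonempty) :
    ∫⁻ lam in Set.Icc (0:ℝ) 1, ∫⁻ η in Set.Icc (0:ℝ) 1,
        volume ((1 - η) • ((1 - lam) • K) + η • (lam • (-K)))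
      ≤ volume K / (n + 1) := by
  have hK0 : volume K ≠ 0 := (Measure.measure_pos_of_nonempty_interior volume hK_int).ne'
  calc _ ≤ ∫⁻ _ in Set.Icc (0:ℝ) 1, volume K / (n + 1) := by
        refine setLIntegral_mono' measurableSet_Icc fun c hc => ?_
        simpa using lintegral_measure_smul_add_smul_neg_le volume hK_compact hK_conv hK0 hc.1 hc.2
    _ = volume K / (n + 1) := by simp
end
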